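/- The sequence (ρ_q(n))_{n≥1} of abelian complexities of the 4-bonacci word is automatic with respect to the 4-bonacci numeration system: there exists a deterministic finite automaton with output (Q, {0,1}, δ, q_0, {4,…,16}, τ) with at most 5665 states such that for every n ≥ 1, ρ_q(n) = τ(δ(q_0, ⟨n⟩_Q)), where the automaton reads the normal Q-representation of n starting from the most significant digit. -/

import Mathlib

/-- The m-bonacci substitution on letters. -/
def mbSub (m : ℕ) (ℓ : ℕ) : List ℕ :=
  if ℓ = m - 1 then [0] else [0, ℓ + 1]

/-- Application of the m-bonacci substitution to a word. -/
def mbApply (m : ℕ) (w : List ℕ) : List ℕ := w.flatMap (mbSub m)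

/-- σ_m^k(0). -/
def mbIter (m k : ℕ) : List ℕ := (mbApply m)^[k] [0]

/-- w is a factor of the m-bonacci word. -/
def mbFactor (m : ℕ) (w : List ℕ) : Prop := ∃ k, w <:+: mbIter m k

/-- The prefix of length n of the m-bonacci word. -/
def mbPrefix (m n : ℕ) : List ℕ := (mbIter m n).take n

/-- Abelian complexity: number of distinct Parikh vectors of factors of length n. -/
noncomputable def mbAC (m n : ℕ) : ℕ :=
  Set.ncard ((fun (w : List ℕ) (ℓ : ℕ) => w.count ℓ) ''
    {w : List ℕ | mbFactor m w ∧ w.length = n})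

/-- Tribonacci numbers. -/
def tribN : ℕ → ℕ
  | 0 => 0
  | 1 => 0
  | 2 => 1
  | n + 3 => tribN (n + 2) + tribN (n + 1) + tribN n

/-- Value of a digit string (most significant digit first) in the Tribonacci system. -/
def valT : List ℕ → ℕ
  | [] => 0
  | d :: rest => d * tribN (rest.length + 3) + valT rest

/-- L is the normal T-representation of n (MSB first, greedy). -/
def IsNormalTRep (n : ℕ) (L : List ℕ) : Prop :=
  (∀ d ∈ L, d ≤ 1) ∧ (∀ d ∈ L.take 1, d = 1) ∧ valT L = n ∧
    ∀ S, S <:+ L → valT S < tribN (S.length + 3)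

/-- Value of a digit string (MSB first) in the m-bonacci numeration system U_j = |σ_m^j(0)|. -/
def valU (m : ℕ) : List ℕ → ℕ
  | [] => 0
  | d :: rest => d * (mbIter m rest.length).length + valU m rest

/-- L is the normal U-representation of n (MSB first, greedy) in the m-bonacci system. -/
def IsNormalURep (m n : ℕ) (L : List ℕ) : Prop :=
  (∀ d ∈ L, d ≤ 1) ∧ (∀ d ∈ L.take 1, d = 1) ∧ valU m L = n ∧
    ∀ S, S <:+ L → valU m S < (mbIter m S.length).length

namespace FourBonacci

/-! ### Prefixes of the iterates of the substitution -/

abbrev Vec := ℤ × ℤ × ℤ × ℤ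

def vecSum (x : Vec) : ℤ := x.1 + x.2.1 + x.2.2.1 + x.2.2.2

/-- The incidence matrix of the substitution, followed by adding `c` to the first coordinate. -/
def shiftAdd (x : Vec) (c : ℤ) : Vec :=
  (x.1 + x.2.1 + x.2.2.1 + x.2.2.2 + c, x.1, x.2.1, x.2.2.1)

theorem vecSum_add (x y : Vec) : vecSum (x + y) = vecSum x + vecSum y := by
  simp only [vecSum, Prod.fst_add, Prod.snd_add]; ring

theorem vecSum_sub (x y : Vec) : vecSum (x - y) = vecSum x - vecSum y := by
  simp only [vecSum, Prod.fst_sub, Prod.snd_sub]; ring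

theorem shiftAdd_add (x y : Vec) (c d : ℤ) :
    shiftAdd (x + y) (c + d) = shiftAdd x c + shiftAdd y d := by
  ext <;> simp [shiftAdd]; ring

theorem shiftAdd_sub (x y : Vec) (c d : ℤ) :
    shiftAdd (x - y) (c - d) = shiftAdd x c - shiftAdd y d := by
  ext <;> simp [shiftAdd]; ring

def parikh (w : List ℕ) : Vec := (w.count 0, w.count 1, w.count 2, w.count 3)

theorem parikh_append (u v : List ℕ) : parikh (u ++ v) = parikh u + parikh v := by
  simp [parikh, List.count_append]

theorem vecSum_parikh {w : List ℕ} (hw : ∀ a ∈ w, a < 4) : vecSum (parikh w) = w.length := by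
  induction w with
  | nil => rfl
  | cons a w ih =>
    have ha : a < 4 := hw a (by simp)
    have := ih fun b hb => hw b (by simp [hb])
    simp only [vecSum, parikh, List.count_cons, List.length_cons] at *
    interval_cases a <;> simp <;> linarith

theorem mbApply_append (u v : List ℕ) : mbApply 4 (u ++ v) = mbApply 4 u ++ mbApply 4 v := by
  simp [mbApply]

theorem mbApply_cons (a : ℕ) (w : List ℕ) : mbApply 4 (a :: w) = mbSub 4 a ++ mbApply 4 w := by
  simp [mbApply]

theorem mbApply_isPrefix {u v : List ℕ} (h : u <+: v) : mbApply 4 u <+: mbApply 4 v := by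
  obtain ⟨t, rfl⟩ := h
  exact ⟨mbApply 4 t, (mbApply_append u t).symm⟩

theorem parikh_mbApply {w : List ℕ} (hw : ∀ a ∈ w, a < 4) :
    parikh (mbApply 4 w) = shiftAdd (parikh w) 0 := by
  induction w with
  | nil => rfl
  | cons a w ih =>
    have ha : a < 4 := hw a (by simp)
    have := ih fun b hb => hw b (by simp [hb])
    rw [mbApply_cons, parikh_append, this, ← List.singleton_append, parikh_append,
      ← add_zero (0 : ℤ), shiftAdd_add]
    congr 1
    interval_cases a <;> rfl

theorem mbIter_succ (k : ℕ) : mbIter 4 (k + 1) = mbApply 4 (mbIter 4 k) :=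
  Function.iterate_succ_apply' ..

theorem lt_of_mem_mbIter {k a : ℕ} (ha : a ∈ mbIter 4 k) : a < 4 := by
  induction k generalizing a with
  | zero => simp_all [mbIter]
  | succ k ih =>
    rw [mbIter_succ, mbApply, List.mem_flatMap] at ha
    obtain ⟨b, hb, hab⟩ := ha
    have := ih hb
    unfold mbSub at hab
    split_ifs at hab <;> simp at hab <;> omega

theorem mbIter_isPrefix_succ (k : ℕ) : mbIter 4 k <+: mbIter 4 (k + 1) := by
  induction k with
  | zero => exact ⟨[1], rfl⟩
  | succ k ih =>
    rw [mbIter_succ k, mbIter_succ (k + 1)]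
    exact mbApply_isPrefix ih

/-- The image of the first unit vector under a power of the incidence matrix. -/
def powVec (k : ℕ) : Vec := (shiftAdd · 0)^[k] (1, 0, 0, 0)

theorem powVec_succ (k : ℕ) : powVec (k + 1) = shiftAdd (powVec k) 0 :=
  Function.iterate_succ_apply' ..

theorem parikh_mbIter (k : ℕ) : parikh (mbIter 4 k) = powVec k := by
  induction k with
  | zero => rfl
  | succ k ih => rw [mbIter_succ, parikh_mbApply fun _ => lt_of_mem_mbIter, ih, powVec_succ]

theorem length_mbIter (k : ℕ) : ((mbIter 4 k).length : ℤ) = vecSum (powVec k) := by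
  rw [← parikh_mbIter, vecSum_parikh fun _ => lt_of_mem_mbIter]

theorem length_mbIter_add_four (k : ℕ) :
    (mbIter 4 (k + 4)).length = (mbIter 4 (k + 3)).length + (mbIter 4 (k + 2)).length +
      (mbIter 4 (k + 1)).length + (mbIter 4 k).length := by
  zify
  simp only [length_mbIter, powVec_succ, vecSum, shiftAdd]
  ring

theorem length_mbIter_lt_succ (k : ℕ) : (mbIter 4 k).length < (mbIter 4 (k + 1)).length := by
  have h0 : 0 ∈ mbIter 4 k := by
    induction k with
    | zero => simp [mbIter]
    | succ k ih => exact (mbIter_isPrefix_succ k).subset ih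
  have h1 : 0 < (mbIter 4 k).count 0 := List.count_pos_iff.2 h0
  zify
  rw [length_mbIter, length_mbIter, powVec_succ, ← parikh_mbIter]
  simp only [vecSum, shiftAdd, parikh]
  omega

/-- `v` is the Parikh vector of a prefix of `mbIter 4 k` that is followed by the letter `a`. -/
def PrefixVec (k : ℕ) (v : Vec) (a : ℕ) : Prop := ∃ p, p ++ [a] <+: mbIter 4 k ∧ parikh p = v

theorem PrefixVec.succ {k : ℕ} {v : Vec} {a : ℕ} (h : PrefixVec k v a) :
    PrefixVec (k + 1) v a := by
  obtain ⟨p, hp, rfl⟩ := h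
  exact ⟨p, hp.trans (mbIter_isPrefix_succ k), rfl⟩

theorem PrefixVec.mono {k l : ℕ} (hkl : k ≤ l) {v : Vec} {a : ℕ} (h : PrefixVec k v a) :
    PrefixVec l v a :=
  Nat.le_induction h (fun _ _ => PrefixVec.succ) l hkl

theorem prefixVec_zero {v : Vec} {a : ℕ} : PrefixVec 0 v a ↔ v = 0 ∧ a = 0 := by
  constructor
  · rintro ⟨p, hp, rfl⟩
    have h1 := hp.length_le
    simp only [mbIter, Function.iterate_zero, id, List.length_append, List.length_cons,
      List.length_nil] at h1
    obtain rfl : p = [] := List.eq_nil_of_length_eq_zero (by omega)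
    simp [mbIter] at hp
    exact ⟨rfl, hp⟩
  · rintro ⟨rfl, rfl⟩
    exact ⟨[], by simp [mbIter], rfl⟩

theorem exists_isPrefix_of_isPrefix_mbApply {w p : List ℕ} {b : ℕ} (h : p ++ [b] <+: mbApply 4 w) :
    ∃ p' a, p' ++ [a] <+: w ∧
      (p = mbApply 4 p' ∧ b = 0 ∨ p = mbApply 4 p' ++ [0] ∧ a ≠ 3 ∧ b = a + 1) := by
  induction w generalizing p with
  | nil => simp [mbApply] at h
  | cons c w ih =>
    rw [mbApply_cons, mbSub] at h
    split_ifs at h with hc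
    · rcases p with _ | ⟨x, p⟩
      · exact ⟨[], c, by simp, .inl ⟨rfl, by simpa using h⟩⟩
      · simp only [List.cons_append, List.nil_append, List.cons_prefix_cons] at h
        obtain ⟨p', a, hp, h'⟩ := ih h.2
        refine ⟨c :: p', a, by simpa using hp, ?_⟩
        simpa [mbApply_cons, mbSub, hc, h.1] using h'
    · rcases p with _ | ⟨x, _ | ⟨y, p⟩⟩
      · exact ⟨[], c, by simp, .inl ⟨rfl, by simpa using h⟩⟩
      · simp only [List.cons_append, List.nil_append, List.cons_prefix_cons] at h
        exact ⟨[], c, by simp, .inr ⟨by simp [mbApply, h.1], hc, h.2.1⟩⟩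
      · simp only [List.cons_append, List.nil_append, List.cons_prefix_cons] at h
        obtain ⟨p', a, hp, h'⟩ := ih h.2.2
        refine ⟨c :: p', a, by simpa using hp, ?_⟩
        simpa [mbApply_cons, mbSub, hc, h.1, h.2.1] using h'

def digitVal (d : Bool) : ℤ := if d then 1 else 0

theorem PrefixVec.exists_pred {k : ℕ} {v : Vec} {b : ℕ} (h : PrefixVec (k + 1) v b) :
    ∃ u a d, PrefixVec k u a ∧ v = shiftAdd u (digitVal d) ∧
      (d = false ∧ b = 0 ∨ d = true ∧ a < 3 ∧ b = a + 1) := by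
  obtain ⟨p, hp, rfl⟩ := h
  rw [mbIter_succ] at hp
  obtain ⟨p', a, hp', h⟩ := exists_isPrefix_of_isPrefix_mbApply hp
  have hlt : ∀ c ∈ p' ++ [a], c < 4 := fun c hc => lt_of_mem_mbIter (hp'.subset hc)
  have hlt' : ∀ c ∈ p', c < 4 := fun c hc => hlt c (by simp [hc])
  have ha : a < 4 := hlt a (by simp)
  rcases h with ⟨rfl, rfl⟩ | ⟨rfl, ha3, rfl⟩
  · exact ⟨parikh p', a, false, ⟨p', hp', rfl⟩, parikh_mbApply hlt', .inl ⟨rfl, rfl⟩⟩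
  · refine ⟨parikh p', a, true, ⟨p', hp', rfl⟩, ?_, .inr ⟨rfl, by omega, rfl⟩⟩
    rw [parikh_append, parikh_mbApply hlt']
    ext <;> simp [shiftAdd, parikh, digitVal]

theorem PrefixVec.zero_digit {k : ℕ} {v : Vec} {a : ℕ} (h : PrefixVec k v a) :
    PrefixVec (k + 1) (shiftAdd v 0) 0 := by
  obtain ⟨p, hp, rfl⟩ := h
  have hlt : ∀ c ∈ p, c < 4 := fun c hc => lt_of_mem_mbIter (hp.subset (by simp [hc]))
  refine ⟨mbApply 4 p, ?_, parikh_mbApply hlt⟩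
  rw [mbIter_succ]
  refine .trans ?_ (mbApply_isPrefix hp)
  rw [mbApply_append, List.prefix_append_right_inj, mbApply_cons, mbSub]
  split_ifs <;> simp

theorem PrefixVec.one_digit {k : ℕ} {v : Vec} {a : ℕ} (h : PrefixVec k v a) (ha : a < 3) :
    PrefixVec (k + 1) (shiftAdd v 1) (a + 1) := by
  obtain ⟨p, hp, rfl⟩ := h
  have hlt : ∀ c ∈ p, c < 4 := fun c hc => lt_of_mem_mbIter (hp.subset (by simp [hc]))
  refine ⟨mbApply 4 p ++ [0], ?_, ?_⟩
  · rw [mbIter_succ]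
    refine .trans ?_ (mbApply_isPrefix hp)
    rw [mbApply_append, List.append_assoc, List.prefix_append_right_inj, mbApply_cons, mbSub,
      if_neg (by omega)]
    simp
  · rw [parikh_append, parikh_mbApply hlt]
    ext <;> simp [shiftAdd, parikh]

/-! ### Signed digit strings -/

/-- A vector together with the signed length of the current run of equal nonzero digits. -/
abbrev Node := Vec × ℤ

def nodeSucc (d : Bool) (q : Node) : List Node :=
  (shiftAdd q.1 (-digitVal d), 0) ::
    ((if q.2 < 3 then [(shiftAdd q.1 (1 - digitVal d), max q.2 0 + 1)] else []) ++
      (if -3 < q.2 then [(shiftAdd q.1 (-1 - digitVal d), min q.2 0 - 1)] else []))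

theorem mem_nodeSucc {d : Bool} {q r : Node} :
    r ∈ nodeSucc d q ↔ r = (shiftAdd q.1 (-digitVal d), 0) ∨
      (q.2 < 3 ∧ r = (shiftAdd q.1 (1 - digitVal d), max q.2 0 + 1)) ∨
      (-3 < q.2 ∧ r = (shiftAdd q.1 (-1 - digitVal d), min q.2 0 - 1)) := by
  unfold nodeSucc
  split_ifs <;> simp [*]

/-- The vectors `v - u - evalDigits D`, where `u` and `v` are the vectors of two admissible digit
strings of the same length as `D`. All digit strings have their least significant digit first. -/
def reach : List Bool → List Node
  | [] => [(0, 0)]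
  | d :: D => (reach D).flatMap (nodeSucc d)

def evalDigits : List Bool → Vec
  | [] => 0
  | d :: D => shiftAdd (evalDigits D) (digitVal d)

theorem exists_mem_reach {D : List Bool} {u v : Vec} {a b : ℕ} (hu : PrefixVec D.length u a)
    (hv : PrefixVec D.length v b) :
    ∃ s : ℤ, (v - u - evalDigits D, s) ∈ reach D ∧ -(a : ℤ) ≤ s ∧ s ≤ b := by
  induction D generalizing u v a b with
  | nil =>
    obtain ⟨rfl, rfl⟩ := prefixVec_zero.1 hu
    obtain ⟨rfl, rfl⟩ := prefixVec_zero.1 hv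
    exact ⟨0, by simp [reach, evalDigits], by simp, by simp⟩
  | cons d D ih =>
    obtain ⟨u, a, e, hu', rfl, he⟩ := hu.exists_pred
    obtain ⟨v, b, f, hv', rfl, hf⟩ := hv.exists_pred
    obtain ⟨s, hs, h1, h2⟩ := ih hu' hv'
    simp only [reach, List.mem_flatMap, evalDigits, ← shiftAdd_sub]
    rcases he with ⟨rfl, rfl⟩ | ⟨rfl, ha, rfl⟩ <;> rcases hf with ⟨rfl, rfl⟩ | ⟨rfl, hb, rfl⟩
    · exact ⟨0, ⟨_, hs, mem_nodeSucc.2 (.inl (by simp [digitVal]))⟩, by simp, by simp⟩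
    · exact ⟨max s 0 + 1, ⟨_, hs,
        mem_nodeSucc.2 (.inr (.inl ⟨by dsimp; omega, by simp [digitVal]⟩))⟩,
        by push_cast; omega, by push_cast; omega⟩
    · exact ⟨min s 0 - 1, ⟨_, hs,
        mem_nodeSucc.2 (.inr (.inr ⟨by dsimp; omega, by simp [digitVal]⟩))⟩,
        by push_cast; omega, by push_cast; omega⟩
    · exact ⟨0, ⟨_, hs, mem_nodeSucc.2 (.inl (by simp [digitVal]))⟩,
        by push_cast; omega, by push_cast; omega⟩

theorem exists_prefixVec_of_mem_reach {D : List Bool} {q : Node} (h : q ∈ reach D) :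
    ∃ u v a b, PrefixVec D.length u a ∧ PrefixVec D.length v b ∧ v - u = q.1 + evalDigits D ∧
      (b : ℤ) = max q.2 0 ∧ (a : ℤ) = max (-q.2) 0 := by
  induction D generalizing q with
  | nil =>
    obtain rfl : q = (0, 0) := by simpa [reach] using h
    exact ⟨0, 0, 0, 0, prefixVec_zero.2 ⟨rfl, rfl⟩, prefixVec_zero.2 ⟨rfl, rfl⟩, rfl, rfl, rfl⟩
  | cons d D ih =>
    obtain ⟨r, hr, hq⟩ := List.mem_flatMap.1 h
    obtain ⟨u, v, a, b, hu, hv, huv, hb, ha⟩ := ih hr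
    rcases mem_nodeSucc.1 hq with rfl | ⟨hlt, rfl⟩ | ⟨hlt, rfl⟩
    · refine ⟨_, _, _, _, hu.zero_digit, hv.zero_digit, ?_, by simp, by simp⟩
      rw [← shiftAdd_sub, huv, evalDigits, ← shiftAdd_add]; congr 1; ring
    · refine ⟨_, _, _, _, hu.zero_digit, hv.one_digit (by omega), ?_, ?_, ?_⟩
      · rw [← shiftAdd_sub, huv, evalDigits, ← shiftAdd_add]; congr 1; ring
      · push_cast; omega
      · push_cast; omega
    · refine ⟨_, _, _, _, hu.one_digit (by omega), hv.zero_digit, ?_, ?_, ?_⟩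
      · rw [← shiftAdd_sub, huv, evalDigits, ← shiftAdd_add]; congr 1; ring
      · push_cast; omega
      · push_cast; omega

/-- The Parikh vectors of the factors of length `n`. -/
def factorVecs (n : ℤ) : Set Vec :=
  {x | vecSum x = n ∧ ∃ k u v a b, PrefixVec k u a ∧ PrefixVec k v b ∧ v - u = x}

theorem factorVecs_eq (n : ℕ) :
    factorVecs n = parikh '' {w | mbFactor 4 w ∧ w.length = n} := by
  ext x
  constructor
  · rintro ⟨hx, k, u, v, a, b, ⟨p, hp, rfl⟩, ⟨q, hq, rfl⟩, rfl⟩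
    have hp' : ∀ c ∈ p, c < 4 := fun c hc => lt_of_mem_mbIter (hp.subset (by simp [hc]))
    have hq' : ∀ c ∈ q, c < 4 := fun c hc => lt_of_mem_mbIter (hq.subset (by simp [hc]))
    rw [vecSum_sub, vecSum_parikh hp', vecSum_parikh hq'] at hx
    obtain ⟨w, rfl⟩ : p <+: q := List.prefix_of_prefix_length_le
      ((List.prefix_append _ _).trans hp) ((List.prefix_append _ _).trans hq) (by omega)
    refine ⟨w, ⟨⟨k, ?_⟩, ?_⟩, by rw [parikh_append, add_sub_cancel_left]⟩
    · exact List.IsInfix.trans ⟨p, [b], rfl⟩ hq.isInfix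
    · simp at hx; exact_mod_cast hx
  · rintro ⟨w, ⟨⟨k, s, t, hk⟩, rfl⟩, rfl⟩
    have hw : ∀ c ∈ w, c < 4 := fun c hc => lt_of_mem_mbIter (k := k) (by simp [← hk, hc])
    refine ⟨vecSum_parikh hw, k + 1, parikh s, parikh (s ++ w), ?_⟩
    obtain ⟨r, hr⟩ := mbIter_isPrefix_succ k
    have hr0 : r ≠ [] := by
      rintro rfl
      have := length_mbIter_lt_succ k
      simp [← hr] at this
    rw [← hk] at hr
    obtain ⟨b, z, hz⟩ := List.exists_cons_of_ne_nil (l := t ++ r) (by simp [hr0])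
    obtain ⟨a, y, hy⟩ := List.exists_cons_of_ne_nil (l := w ++ t ++ r) (by simp [hr0])
    refine ⟨a, b, ⟨s, ⟨y, ?_⟩, rfl⟩, ⟨s ++ w, ⟨z, ?_⟩, rfl⟩, ?_⟩
    · rw [← hr]; simpa using hy.symm
    · rw [← hr]; simpa using hz.symm
    · rw [parikh_append, add_sub_cancel_left]

theorem mbAC_eq_ncard (n : ℕ) : mbAC 4 n = (factorVecs n).ncard := by
  let g : (ℕ → ℕ) → Vec := fun f => (f 0, f 1, f 2, f 3)
  have hg : Set.InjOn g ((fun (w : List ℕ) (ℓ : ℕ) => w.count ℓ) ''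
      {w : List ℕ | mbFactor 4 w ∧ w.length = n}) := by
    rintro _ ⟨w, ⟨⟨k, hk⟩, -⟩, rfl⟩ _ ⟨w', ⟨⟨k', hk'⟩, -⟩, rfl⟩ h
    simp only [g, Prod.mk.injEq, Nat.cast_inj] at h
    funext c
    by_cases hc : c < 4
    · interval_cases c <;> simp [h]
    · dsimp only
      rw [List.count_eq_zero.2 fun h => hc (lt_of_mem_mbIter (hk.subset h)),
        List.count_eq_zero.2 fun h => hc (lt_of_mem_mbIter (hk'.subset h))]
  rw [mbAC, ← hg.ncard_image, Set.image_image, factorVecs_eq]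
  rfl

theorem evalDigits_append_replicate (L : List Bool) (m : ℕ) :
    evalDigits (L ++ List.replicate m false) = evalDigits L := by
  induction L with
  | nil =>
    induction m with
    | zero => rfl
    | succ m ih =>
      simp only [List.nil_append] at ih ⊢
      rw [List.replicate_succ]
      simp only [evalDigits] at ih ⊢
      rw [ih]
      rfl
  | cons d L ih => simp [evalDigits, ih]

theorem factorVecs_vecSum_evalDigits (L : List Bool) :
    factorVecs (vecSum (evalDigits L)) = (· + evalDigits L) ''
      {x | vecSum x = 0 ∧ ∃ m s, (x, s) ∈ reach (L ++ List.replicate (m + 5) false)} := by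
  ext x
  constructor
  · rintro ⟨hx, k, u, v, a, b, hu, hv, rfl⟩
    have hk : k ≤ (L ++ List.replicate (k + 5) false).length := by simp; omega
    obtain ⟨s, hs, -⟩ := exists_mem_reach (hu.mono hk) (hv.mono hk)
    rw [evalDigits_append_replicate] at hs
    exact ⟨_, ⟨by rw [vecSum_sub, hx, sub_self], k, s, hs⟩, by simp⟩
  · rintro ⟨x, ⟨hx, m, s, hs⟩, rfl⟩
    obtain ⟨u, v, a, b, hu, hv, huv, -⟩ := exists_prefixVec_of_mem_reach hs
    rw [evalDigits_append_replicate] at huv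
    exact ⟨by simp [vecSum_add, hx], _, u, v, a, b, hu, hv, huv⟩

/-! ### Tables -/

def vecMask : ℕ :=
  8903918512065250278490029283120994694212734492805184921216753841869790215014841552648004389019773209676785814443633417382596626645217151665759338643339951104907230479835463680

def coordMasks : List (List ℕ) :=
  [[45672013640509739557345472318175355234431270912,
    15438711384239728430922557013938221021028788951771188738164730898500324163584,
    525826886919810329663617855611219423251989069921857297301468428865604443551859001412219305984,
    302598163554748445141613180376863127645617016857633594202725504347493995849609248686436960436224,
    67043063853569273110325507904490607202045929096107077707253962713649072424250675469885124902912],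
  [3794275181895227526411291760177957198744958401740334056998992493242360933193351168,
    21661523311482652321310220964711955034907507431081143931799912250459427602930616837200741431565211198545695971699564070274334720,
    5545349967719385244030511775611445498976038392209969226352002665587172699363494181834156312633267380548716601026237225704330629121,
    2708346304133648547491924025185344279019469679315306194853200602805154379682607613775666354016700090459677853455309814964945152,
    9619630423521110385791175637712241181633765805616526077897404079188856174870097073030185763731032281041667620864],
  [1560874275157996115690798614896583152910995049205414615902718894796679434333702868297559816705382286448901071533608399126114619524730380691177472,
    3196670898084962835787314525849992300941060302676258122438923433087910495930181362335289883623269353746472072896891475861868410916476777127974273024,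
    5567085487983329931355605145964004635661224366066098118279217492420786765055120483037237778488014514903082799514600348070468125186,
    5309105749346721784371197842957362143720496974433835724261084360363012015734887649504654134261176983656179377639447277342720,
    77257656802928017864652354710513841921559871313348471409584305015035664955435848354282219973210340108584947286273],
  [1494380417151767766969409749022434416790609284336649926152051681477915223944191454569326853304041014766742451651080741042000475101169975296,
    6120982188653642132640366545866016419763363866018355178589751302754666443848804970093580071301080539075996176034601793706487397983333612781568,
    11362422163222621586992841567474631053005178018937347319932695354040122218346665279379749689382718017323936071456348494330133886271488,
    19701040822307802958837176090484744689780702182361767067598817541261094911258357443409089296453917266494720898498560,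
    603576595001672618958960740387763603188754606251721006422836799853066222217248561674836466959124722955152523778]]

def shiftMasks : List ℕ :=
  [14301805413071954570800621078829888599683304824554223729372108308963738495398611255733060418818592735314816652184017053220175966371840,
  44731394365159141216090440803795193137801301552229539126791944196224264818245590401926617912673546054402669293862912,
  369347886736673783954645175627927684228180368020938494142717061748355398585449412214823401291776,
  2264439971340968464332386224780399740465870789504948689078567403880122941440]

def rowBlocks : List ℕ :=
  [521640372045180160073517275261689389559545237886852074981147724852395886501475428501173583873,
  521775660478232204558908280515136789332729033361302545131971381650171576727705276268157255701,
  456717839525459985714725951203953997114004348190710411789807593252351982438251869487465758758,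
  456877002418228357178475872505227504226026073279821945011396305960473721008083291322244849718,
  456980458157380727050044087503079463376988783908890294788285595983566300198532146294214451274,
  652679158643789387789885579709612195840446876413081213124045797828779726637278445397904916567,
  587326899964023524871515374584242022589839180846178513395621661498396439660246030431372001385,
  522587391137252874282634462791688205681852376604004025045602685574152101257784584596985167993,
  653077065799606197693179597205110757412191259292424030083327881594890500059835273522812387398,
  588003281845698864979497169181856256458422679501488340738157064123233501162063753002218930331,
  521934943846878026811783382468955882692767176803378726619317297550305227181832462301165027477,
  588234114665691493338289763586834465248738396725474431590451682127647228644802714244625113105,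
  457975065928445341465248419953274958513461282332339789684725754594203214765558065771733868742,
  522364674833100954941062043743911078131855202131081882201677569714641272336373462150772588643,
  652599717965551725742568880636926866274747659087419428643186026027676023457274109127967916155,
  523486661278808780244038887424194834780480156586941554488537745583638305012930452962880766192,
  653960419625418714110142999667658968538023640705650523462412392966539901431545884782926741757,
  653896776820930323348648461544579086468540934606679918306729239685749830559049952115715825930,
  523812880158516293643837289180231048022866465754627915360989494236838411526447509005855293561,
  522547600391951056817022746690834505533967892513780621955710023153359311247835353138986279206,
  589252757030762411172689133609877777094169424492515312966567387886837352137118527380831789366,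
  653244252856450403232589233302730046228686554226065676431181410267524817694026627437245538630,
  718700051872846747713169284397227648245089429646225513968477025895780849166866614702069809488,
  524377973339412286418514473490453091445761922713212733462051077144620482135828198120786239838,
  586666726650306887345886124593496300459134055900565191566711127057291709672555044004273021293,
  654963145658724323936317309083054044608018871741768838284853693898352004131968764940099993977,
  785468736607155959879259499874834012641749125317453871043212446521479273460894366631891911049,
  654000356071361812559649861785086069488015003679007158004483593389173200351383291978841268531,
  720474580769376927113399511398303102705329391395488791425666046697030692956194699557189771465,
  589650507802229946851792927175450193045565162003382515251327825920273812592155404559885681073,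
  524576994910189012453036936529402378834444648180105309926196083270016868990249973038597021790,
  590438520355747977403695589733687549127878893253126023765226727370873357476654539456097386955,
  523606247180395160745735428344729872605046682651533839664197274893249906756230732635576631460,
  594106686213488211341754596743495748261853772493441245102944214072005684023154851207863656686,
  719607143200255769314424428585527867754989565496762465600046594646375243940737902701407248880,
  525603527349647193728352551685083939474960689486541816591463365894380571339790596476521955654,
  655623730880433000267699326461142940550351166241510317623204686108682818289776819065586770439,
  525842271643268448677633425734235533186588034256018012505731200372127290995457369479791510039,
  675349585894812266073436497231251000615480512957665414743334727709702156798456994604593234469,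
  721628511612942263691749682421310723320009710629529576715428654700227637944952687729729495602,
  667909659509329229930780603772264513917575979294315432154854749369138305385971219480468546114,
  721485309718128115744748723874186439221290265088344026861459835260387478888859256944967189072,
  591592451137411789892637966712409720298978588637899215296405181339165048080804953217905172995,
  719511958313718718844949352203802651686518539921751272825716000643722325463290526588125315692,
  526629657716704578610572726786810418532154845805142949624269655929422740364211970150529761913,
  654080157997162910928435304515325590094834730819161581673107835389314904637780102440014652040,
  526789151802141703459356236374554775332615162933026753491224588428757276424477985106102985056,
  589237103066863935257994439330776853956062849344983141504858688351565754855607147550555218588,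
  526979859724065827614259871532251512367506391470964523480451014301424226848822902467557450369,
  786670560007165273309925791038859389476479802451917506320683757123307390849624086661352039092,
  722750609701454711123023997562472914284306251301744811963912680414729229569309723491089015194,
  656332111505573065575499854199771424420737241549943132092142893502238595293978948012103828175,
  657820119039058404827203688452079560930398879876399432276509455854003231560533440663492739805,
  527545314346878116312437624827516904006457688769235648407281352136476900105608805572292387567,
  658003156399591386981398512917246029306947399813586482936489856166931204505832178395966710355,
  720665902725663980764456554563164919690974474362699991805522347064901643878985791422927954694,
  720252145273673066002819280500362264837813142190765575795703392638313720365341056658393211672,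
  725297006814594623235148439158417481835034324169529207666816553338632324592573158329445318998,
  788230291039876327173416305757011012283176603993614834401712914792498022711527663346911478052,
  658592059010462287314500196021203834627689307283142268487871946757486771744019778350266114884,
  592507761866445899529179909056846805275483246735920202371512024418767057410416440382644167504,
  723005394643399875814166709772024602138059863767707458147102412426812005668466732557490963167,
  658950037493419716111130681673276593270415142634745865448829517482335593283493254306674369390,
  789447808198242212031077294565257206302340215669033230363523160744306680715113988786993742717,
  653491583748880271740221987668085180756321485570320658985169932322933325387090085750970196877,
  724468829521525411525658623618885055926873100872132065449091465362902317232687231013523497745,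
  789750217667187182877137435514980444229911338918639701230178479068958095838372387823925125538,
  853399644438884705615926485989071184151021712278929080049658529206738467655562833844204422067,
  594345968627519014303106010934776186790417004129277864857882033045683764337691803863686898499,
  588648625891161653321323163336368682258308628091533137074855618423851416723639797280523412422,
  594560812234471586111322461766989266757866787545833710280494305724373503731759514031350243738,
  659037795648656296262902427890426412833524711065561804316948853865927013240490773486725473249,
  718231222709685391446043594249287254205900510298954028668097539680684738244415640534345065450,
  594823457241821712983371748901183932918185120172853693448444751717824324130528720398149665781,
  725272617396650905216923151276371458444337571946033506539878383283881911830148779146438493186,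
  854593306716072116682354972284783702072532228093621923161650471942486451229270821317440668684,
  587089114348080243311851276473601907564177127084476581581050849437082620361969621665969464136,
  654462499550221167696166145700082824660973123019298148822098885947036343169537074722075042846,
  915839686060890233839819295993567638691399503270144930274938422792626794328748400500501636138,
  660494055187154244031464590200074185669692448632512793029018603676417873506278878531543385138,
  598261026302331328697178326544258095006022832550968228401960851838492273038012044189203178560,
  595468066897112255122189723057014677295270209947316494776542475653474989814013508401117783114,
  588553299128746182336988642978712197804866276991623580998023351801908243191290013173238367315,
  592977494407866483145129964064284497260463122830097385863799272682173095000776914611884270054,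
  657103886247197560387635345285971712578962329789465752523850353765072237959273581899200414825,
  782222092111275345951998202718862031644207478859455315236303022469019319473392481994788709494,
  659761980780920278782445295082184275113754400377972041186187612235830275204227428212882023552,
  726339732398842366991043000393379978099138991413173814154180184454388632123502700309706253448,
  723148918111654326581541970771289160025740751431407189736900193301547438575708852233534088338,
  726490937057771822430887430368413573229474341086505930906960053267586047983189554987539882753,
  653618961725443753012137316309920110165992047067833976693785482996689486096718062202696025253,
  524132124766590660008298874114413925711810309496648480490619536732975433535847539488858522799,
  655034896194668935446205887560385835375090388694601268568401638933625417043639896443547821244,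
  661624111478365541277024472711099816208325759797303387906102561727592655723141866478044112069,
  661703692919336287186439879187754340146134815536444381071827658924881365135270167320020501709,
  784069090388917930603879383353308906915386899101704251098925917089178946014647495974404678193,
  653189541445760570135764152364502360174102886022430400302835999045702580015006570318181171399,
  595062410372897649861013945724307181892345300432267125997129428615386678195698928106671726922,
  658489036426561297346032215718232453550297135709733333795798678222568036201655107487541412298,
  783941816375890935759279182968061213568628142109710486341626793477182911604616400157836050711,
  610061707264799237900339536521739260014838030776653802486382996849446739560851217358432331018,
  531921385791474979211277846187525149853993846575776594584325453063609256075021199731491423507,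
  532032803741210767502781796823707378056051866294169499436984525028895191254508373810350399725,
  719202313313205698030349580719305930904372849045455217150905135566354763399186140534533047599,
  653961473557763690157701369410460118318040570323202879926042044277273455996364457735096935738,
  786742807896037489992896579929543630220579141612801683007906107482689527935966487302040511814,
  597537184015707200867200527972327440511775972298157311387820213890708604038532939421105275038,
  595969632891850616428498365901521479556980163941297044642198081140984650358282299216780525968,
  720236229017145089112337358271376013435422300868972190032656639360875847704488694751305188706,
  532597762907681020383252825766470265933962576166313097157513490244504234848014533495398171027,
  663056577269976531945167306004084625714981325883440758098708929927214455488172187222931334518,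
  726785578737439145367980192463453774768005629037221785419065683562029165560048507597733503601,
  663215035887783496745136523755208371338143804112804333868513365191445629233930326262852724080,
  728495712075654031251629781329120896816586865231175516056093476636093755439413704764825978261,
  533019940795332102283466710327368910277987553053643998586158550018108351819412805229108020641,
  728679426505684482113127460511216734323673098442481940256062398048848402163294808267689780651,
  663557940320151797517125159789812472724613373807521066028421693224460320946537878941850862031,
  728862463770374691536857241584333760356840024146296602628775953466486194449110233508409255360,
  919548139021926194652401556433845674127442079434383373848156368787907472585881314954306815439,
  598659282288249606934634073874981445451701210926923117513205967384706165332736413631541814745,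
  604403334497325642422370749866338440226988257777034218866098694427498244371712193434258023908,
  789408623688711834342394743701903556374719017940405184135860987016051840774243413793587414513,
  533711833003316572124906821265636846927701382810548568285535464586636256545500622741419320823,
  717038165656869076178159232724800110997627110194482854934792639379288828345648686935431374338,
  664226424281583217450129093070827273288376332089787274962436065576200785377976423244476442123,
  599112896357319886440802028930711816054152705130564975265922345205626466256849423925365548564,
  664369670948818574743056651183761672416137536519887697934226257640945962205461310355434054414,
  657859621419491272172529261484769321686469219593841237301645930927519846610954984456114726438,
  858898668943742477607063217589726291908548334028730358185371949909629396149114168776548058208,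
  599398105369578711018717356551653340078788064601394362125920131817185526198456990985484550478,
  664719829215775445925314477736525248997569609505582344999060426255824500220750684035429713473,
  599654050089528196387216497252988350734231334714678755269885774610826192723060433916332228936,
  599765464123572197437568125775211411003518817044138540139786345118384377204138415471173879393,
  795391965197343108949318534729405254637012805548606333642817950026241397229352166915318866494,
  656229581258015773823864422722243028794194084913823806606069079442691201094098125359080744568,
  795615369174254030311559113498457370568134934628831576810497751663877613066908319510515582141,
  600163346965896315369695978312938416106808353208514714495206954894721782803197040676085859723,
  730612319861003020271047505358572931539886425647867404979060763927115047476625528594976638351,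
  795885363270278090293321135991509360369289892546428454818745890374765267018097647233296336555,
  851984019646965011748271877478005001934641000895758727835373810842881495042229075268035068661,
  651853199911432570599553842786631094086446131721300694530454016982840122348949625937675698864,
  668037353052220848377558536343077362264112484125653169979522960565395742113324083245185853130,
  731035036781619708720826070785348765854600736260689194725742275757825812447673560031370594005,
  660009333133355984743393580928677546226714859478397241257515148559060245976204097228560770784,
  654693948092795950109749181125606195552714331439937349435787485756021713928548158812936627205,
  861651592886549699589246527588561875840966261422366792116447494899871790502092240725110310641,
  666192085749942593365446260027436368704675929407591900120769549070989830963889616601942296319,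
  856790230142727897655389593752987605427757826893936516793401739287634068050847426456325235850,
  731504567189450833288640773989722222009126191762692581975082417095414013042056088839757251329,
  731535327503354934971735553274562085690128515398569049543843242594822865689125669872071976731,
  717038443460280133395136411046428675480411612573144020328341860165359935334012818367929648927,
  731711478946879931091897656560249907164974259173329698993427891301580685644132299984746799738,
  731775144056759348094183802298584225310323280691404617482240573848434912201434779569083179279,
  601516066230269285290272124307010586750326248311283218581194559818108397811196135542798952253,
  722042010602869281747840295982816004676704280573678387082371036981957590448547724731494827351,
  730007449383480008047479141418405879080952609301851572723714068275532019047054425207615784783,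
  862470760142802198959779827568921688267522624310383921687531966423709548880562555984420749884,
  797373050367846361871280032023125134265515028551257873727437651046640508589409712112376005825,
  651853343637868754002495191694387936582343979206872584174089214660151725588657724564333029234,
  589978416748386776967531199280469835760412268869389439849411614493158474957423795074981684971,
  797660611999817645262972631152252098397029125355170566823252379733306194986458596381757784847,
  732618707167235429511522669268226944658923384511231835387904896761568130999894956369482270613,
  720912844021232812090354290668587903280035978152232820434288167820059945644686403590457460647,
  667592718882195691017313581462486616665288584370639782104312568612384370953936387348741038820,
  791341306293216345783321969941434130536080739143969163550631376335760165256428515901740386235,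
  798153776943758846646981787883331936552452684447373062081687563216320690824319843678553696198,
  537483821885712891868341488038300401193810546873670100669401377080832891103938282736707593911,
  663733538129521355351328334196772414590022285711136251172506568268548295650509158078217955292,
  732730189315125698331251469064458062130472946119261546907144247950122757944639835274160736235,
  798392779578628325929326644149086851097636659581366531659467746659775554646277182839083452324,
  863816656685676588533558856383086029450680733363303081324248102332056888643889493546295330819,
  863888279951042071140133841841320589499434496134392465703571732085473660936756204460156363971,
  853894081844824067540588450241245158127881250980933455303702626021649540227677535576782996293,
  790053701405770192016966804278997465323360535890711485267912514591300739057472819300063846549,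
  864127024150528308519125886824153938745199724001941475831553601635594724598650812362499007077,
  731831099785740893416980186153502907864272867891286877791513256345290192782632860604231510070,
  790920974850131747254006050270714369775705414209542981256046017411088258536787019699733915715,
  734027298686068708380548376877999835844486534421980313748767817039999050687064978936450835991,
  603744535693190155608988026830922519126625806838687522881066196308907835453046498015245264984,
  720508086042166803221640684392780168094907321426484434375658948561863935231053343095935240291,
  669104766105639785627509267165505170789898006671104728602854056223313958339381869182333102190,
  919707945881535082296829602067968527472055664865310589759511738220313984267195581378252605561,
  797255038942090486905791986547917340850391213576585686605665419336900831121430785903109276135,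
  604190191675991214898938172365484186365590518645273712768452208916718864396723736133030233496,
  734671908216084932169989204856565399050478080681061489837342388951676589112951134181707647131,
  669588519731103565470220620907202029645925914382849763081291695741973209448507651447473629353,
  669653045541245993530539529100284807252388952462253704411247025579169951962541754731558529206,
  668728945092016568721451565651117191650062717745252543552563920595853117399718404140298078398,
  723006733234485915638197785669280630819546441599535763707700602597500390260755090089193309120,
  669884664100841167402785802904554555203195428412183209452579225767923743754646395731480029392,
  733518180475308711292633435158113480846670097725408457410240146174482495519599744788111149275,
  796093373514895021204830457113072278759348970999559497880430973208827916020986941044535666920,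
  728449482355421077519914120631590271334088750950196561196626624813976436515046188828608628979,
  930999301858381241873708873961500787822314304933068297613379594097713336466786731031500114173,
  788755449813018297844721088292530817494365528532765720219356988174641343318651410015307524362,
  605216792152627529362905532585746234023318249353195689077565280461148915538321081697622354194,
  717037850922132306455672471181437168724019857759149783131908253912077429613952674783667709058,
  724000255868949428121297201146017002979645752649924947885308930738625726810036431698559183143,
  788859522431959026809161047652690964394998234493422857060164154678750012011361361060893378864,
  659572269518751673730498759778340237599783510991723161465387655919038586544822418163489186032,
  605572952303764775702799315906691858288250148300294100865487452932607495958351387043223136577,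
  662548263324708550495053345983901533088132651722853468972668958983462296413980449756106557769,
  856678202309725156550827619420598334728926501357806555286158446481689844594469288938270476621,
  735603074039532059592185483913915718400537891511004228037596509229576943276026278343429014578,
  791890958137452305092069486933407043640002598829909282720649217467572646137424931841393657024,
  736231116675236353926056137538631847050835815523729700987889539382682679766803141268670670908,
  682401444929023399637320831458941719135648946206770123018133882199782731667253267567438416237,
  673385980896770930018079183297704944874261957979844485856166369240899818112819812534123678068,
  919732072857534655404228027682337284001808289591456214896948710204427801615288195795658279166,
  861070963214534671739645421508959839427373294193193526155961955553225967883987213203025257262,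
  801830679010412739720137919215043185726053759751962176755943951326702636192152645269525285269,
  671539957839867634118371006560068099880582715937599172672345186769433147087239992145596180897,
  671603622984834196768976840917235772468459398972185531631763244255995145621743005628200134212,
  671691162612166154771597723273957013928431137968605399368511590309404007035721457774797089204,
  728043865806422527896012862595784349215939094794511390852736777495382699466096235509123163276,
  541480023055651056627094386314857716071366982536567388923943774644515211284029852966993831691,
  932662553771539116764911299758084620117286494597339038048677309678619025791733964041737839916,
  994226749896036193870430524202474229789141721613745119826308165145976521623172208188062280155,
  802427539658475275687859935990567050632749752883430391167014378514520762536899789165990519407,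
  606983499903699944502658926083389545271823370584539457374041018561682535091256895514985114092,
  659246215825767396825509295642029541527919716425507431734061273897306279163211434487640877562,
  862423869851083170123715209829095963180921073248560592518321604011025501096928103245310632288,
  601357092682715285562832984111664949658894418027885753984390799173288534380469246940455897614,
  802483246748293186774382837299273543756332865307189209114098430225013855122294252456124164626,
  863680175342178801356547245482213330832877155883556539746213968204340802169776577615465073139,
  724827779494335965006294663595286354640399861445354365536687057690879805021810245563356022147,
  798862792775162277017967458120037489780422982479426495718110420462537819164908937936667051482,
  794414742438081240986992223810779094850488060263384464924954363703793989803943067066082675247,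
  796960611986299704728809822318302596377434209966559048465463126389164357657939554553496734264,
  672813260793283658460413265818585723626105233245780032336689812228826784409681791985687972416,
  1008271720343551872773605102729878651084275797583096384672619901585864293036006190922863315531,
  789273995700892195623316384295606821712448776352998320843516893189627211147041231596751260118,
  671506823673546610404718863679914844204382300980196805233799745644170769555825287826199701871,
  542671596874799024724650833354499625371756312476563528272936380311976084516910885681608016259,
  673153407522710254084809252993002840285138137171600031783995147474284614857076794294220434024,
  735252395168889078980542387672520018433433084404356128869441539279872820907185555966237001738,
  789312851991706683258168500061048828276656159085748823474722117938441615522123489077265130477,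
  786711070450569490497612925595603036276945678914482989700422944857340517505741983686773443202,
  785184514528873518746910234418890611669310430708165700534158987721905325258526158875010376470,
  803326876853447854537502944207676468307172596098974638271637170040691230933513189866031213206,
  999502790007155970780975918178842504932725276150585235322589578921944989352109705293410355873,
  856917021368430986548301154990959065702238262369750433872325865327787190722404932842172016754,
  804104767156303183915214864629238453341032453122468631453106011447159292034035800224170437302,
  927021150095478492608813285117965923035689639419947642750807219478208877153345321863254370828,
  862558862151129327215129097891033566217847355505254259878039246944827760117282824754573944123,
  673942131032612670764372172624955199121744335776133474510616452191173701112294002380494211791,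
  600092514378468537887739759842668003432592497359585537072378034551285687949052537829260528345,
  674101157938559211453801375507033156097898697392710163215347735004053100422663182694234195349,
  674179750671049553703701277273493568889593251154198779239380818546476591898740456480247433965,
  609034821296059661650801779690162264358772633495466565653914163313719004343899826994591548177,
  663454724375138053346222755891074120557192673023755179625237278488875565520902403781697652746,
  725798508765196133399250932282606522889780159427762746719572347250745189526836466523383448655,
  533220788532967755062383508921947352991537001238375871961590751070201758946161383277460457594,
  595788036124014962742511656639128212911860516791775298266451277864532707392916293299580259088,
  808292270637972539973050365663083650555338826331546509321887010150390693946434945972505528891,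
  786672644461004053983446923895719444959080394417838013698972127667762689652924426322999872283,
  868631014684365780713583189256697638462442334113665969401751411615733263736441916860769856293,
  656063646312111323872684194192811591730050718605422129409291573158871120405483331888827722542,
  674739044920732878848871133419634372272165458736822533361426246097143862979215635746050130335,
  736509091250427075736243486875444676897224952415992590738213333990260906444986212157915384637,
  986644359706840493582693538925405082411571625614467765945422877560598216656537724069069908806,
  674914210552265173660466316111029007322989881957476814057271458139502420217053596187830757776,
  479412139363102624993505760441438197581291919824629344771508336735211477551987818936372445711,
  535718164258200921383186481838895342192976106248536182272773924175959322460762833993169857370,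
  789919245341987262864005883978555494006362791300481567196450752197479769367883936218357631848,
  544894066304594522493860605436045129012832632814975868097247493775256070981363312697742928754,
  870955110950983346454481022748275143080440659798588966721451740423875930967893569431898434432,
  675511071287456270879976758544829423641529451003571205494378580228264660917923257674013738234,
  590558165456783534010519260906337661590654429105609616800748960722456008101271753140431210623,
  675678192232282306372347212630287766814365590356627306559536406641173071897260974001259602499,
  806120118090113632729142229239774410882434223567897251218092635208544544358494521768273143428,
  600036032191912863436533581781415788987437312232019605609293539840533926809717382508826823157,
  862861868841995752358111169879847288661742221886958039079056353334153635742231089272952784948,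
  935607206568540486845919196516138164934361199636803186865114211665846180101086727072697165280,
  666669412041022459350520359209628238203376937065309518293787086905716828206603708527488674780,
  929877203610542648377634925099840596960862425807167329787028446157799006199002452735765007329,
  676147090486579255289613401698184890032162027535951304481497302853423307657731480012284994952,
  739821019194901836833230705584929007750830322421703547531777812398173934294857203899724188654,
  806016743798320185507258717147685321278324112586431891166843037717626715387276681576818592757,
  795130903378935091827313353795402523111928408641523740891846836347774982771168931390253124610,
  611272939075805778819434892134104096485072952835311408356804832980174225635354053576921024088,
  741705433182500487768209636768127626667151316977973696352346469874463986195919189200818193708,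
  1002495052729019658812341990757826359968932628777297923823008777398348911829484622066219207709,
  735189996606290301745208458274336009611868215355050738806889977385124668256618489920219195765,
  676736625328045379657943291810997732124687717299103670069974829452615407551700252012549393450,
  787769151890455075432847431262912315480183952301703465151703294131958450077002479116480883768,
  742056914477319738668308188763179644568986510937139145824139688328838088508177895896906214464,
  735603813258219866105756875397344031099547572122805243957486715055911486533173768548585655369,
  740902616530663735794823233436648775785770669918928467097071891619491275075320782862913145943,
  611949231625522052779736695617154882419517400056573599224882683328682451377427917732541254023,
  732491384778356560052783524660627636583407899613543776272888459687319942276818107211034789753,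
  853911084208536175449220023686449383777355587791138826913751072306279861460807450400150948979,
  742540012516344563908557543485269124220404956632420531410746471873551410136020198126382467173,
  677460816291321258329137495234423278234069180953696243895238929765259659430569299542923069130,
  879365060592782432003818573416915343259766002129602223681828765066877438344147101127505256724,
  726158722322250779604323432730129823584520413786628451404924553520726180303197387696479888138,
  728806756653657367648703860224566526431079237829525591922902696856351675109623350969450794145,
  547351908645245046703723496974405741752333602205294692960696962452171939199080073237127071845,
  805324653400588260599276090200252817567659337408668920007681001236158571463291550162242899124,
  994928151343567559428316478631633333889219587155803844724977393621798542909962116691646770367,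
  732220135706782365043491609304597524947325418829698200158446228279990704017682852864063442120,
  885436214689343221647154878893185220521842949672661943046940608612314902805637945218357628114,
  736932792068690783713076735725410099812011404677902843244064479190276475309187019768415644890,
  739256293036430187507064565650920511257247070458442865684418683910992424435524175213019270366,
  861198933708033802300955306169434198805111665201958376172771563713823661812074710388814161946,
  613030516271404530706988411625560199047729582672666899807478936175183176496453498804878806251,
  654663623117215956328851317156512255181968109075479190387536626429890597336207809620941073650,
  674609963290980558501028719245026197025242882227563243668319817650167258443446950638272113917,
  928127760379735575977627426031203535791484750246754585311953129254856361554775857339533576482,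
  874025542937878201821185589015475948567120689179432271221120397492974369719835381382386412680,
  796205825813999729845237287472970198871248523580057110445564226611377439580519590975877827794,
  613403093144174569365691921651983888150626171106493027980663356603774123185225895778418707741,
  659923359318749534393537328443822575683845304325392462746873199654423981263931434450516372769,
  809126414687766144211864785468938937009305666455015926515567445075782020383089734546894382481,
  660884004179245407307566297265405457866726866724108751338824334710006752671970672509841148286,
  548504698112381381430252493425706317290187683797560528724573050456255984508720993057598588843,
  669352639122099734371394899510447277795918268195970961181737238640435721668919986821816093656,
  612275854485769142319440008797607231547990821713715291945853765771237624849805619373932816245,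
  718803967246648510429540720384524395233700472232244540736284887812057302113573054590451624180,
  804545012900474641043139211141048143814862873290015695615910575577373681170837969560126025052,
  740983133357910151784386775196623421844999446698046753705024331368559427384597821149357403494,
  614103810744435691699037276651485037043639321034631750169430302009950988940345802708689612143,
  782224089092390885127682738438310054081992011792274537337655883534132409874613912934982569337,
  674158834802307406956901265428605178192668187784759039453180579605109511164259710356425854341,
  737473671983951586842939837159286529090214806172949095065620873122632483287835486739256995172,
  659995086509234143793019701501694325426692868504268716024830182869038410986868901467691945367,
  727734498575147256532842069891920100288536765849501744309331730097684823584545945972026650016,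
  731705137140545612961630262526356730047174002421234468279930368354871057925924782126141681065,
  682442296280941447969357468826869193274174621074670605575643647994756027073223052353121283507,
  731060622825605447281382407113732197195735922941446692976641907357495850627727704434921597566,
  998461388232324800311211386665048725411676458159709607469373147995195407969797335772131528132,
  796881564828962751861682925887257281805744374733618292163428192159869295651633484690877385538,
  614901852339159214794004145799154227613382314552641704429932020763183147374765757040994969395,
  932448718369228393340344927470631403676599317206369782770077272549621725011024423195893091805,
  721002799312439212880888381479713253677820842507129594078502463382071338450486139032736443880,
  1059445193566016851564486323123751029560717268802856810225872014402474862712058905468191238150,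
  597762136308525262995301444456733556605613459319896361129298624288465128259911791954093936118,
  847409461799829907512632421447342519304409057796170807819946528417197083631021147094360498481,
  590091439309625086769165219904129506366909169269788377541423393061579956265737053598897991045,
  810949736692308948473623065401018458974056905613611080957561867212712429601753074310722883086,
  597197212106034914660277503751670033647995930361994152869114892670459478385403157075642527259,
  611573282387781032286763348864286632132413633613869545556274993242350104858118033140338665498,
  745971370957973475632710891008410160268337905184769470319460305534230916860649236348554268200,
  746035566390838415608430267682350724905423867174480114196613359400657566170557181045112187337,
  680905299432427051192651152501213875892933229415952559569329424672667106895106237232908725821,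
  615793164368678853376431574622820357774550826567649704378942365012421282224573238971120257285,
  681057861064331679068204595978210790108900501120626234650181688852817217992706683672831053389,
  876658653805728397691633337074777185989668175972447267943229127080423523997395175163650827437,
  664570652711251680929466824282777496054666042311528973585346835336148899847630101314735459933,
  671253619250661170276065294544693501696304783759562533132942100267871217060974300675938512486,
  803479013086029198211909193114798560531337428389295516492262593591430584385564253275623319943,
  1072471146915325269739503738541525939499226941474655701982344312149104510899117562026940852208,
  811815327816038315663805150370144853786963591499184327732677553738499592160860199519789411965,
  681527427479527172499060811941166297315959280269170723080167990117852865588742595239688079897,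
  746815606231497630880380212210508315889113631555281858024280685031682123773295963262904594066,
  1000124543982475144351365781882754683672340200440985208680673727424276399871026794072160594894,
  670227578156863252342696649354045464805109874171356904775593352097898451260191318247854089893,
  729755879687976883442491971279714277033781109164432348389142115746902134148301342766703398572,
  681868280388350055515374994215307283136500087080247568370772237443342452792129757986027900523,
  729397823467155921336543189991785691783995182392391517305680138303779592685238495378469792082,
  668231055634055145902125200930629514228000654669697541616536082082883021949278152317969411734,
  616921148805094549963142819714743631285123208701298972903135350396749235778458755121468737932,
  809231306182577091240738643558329308853027173494480818451771627620466484864581031951089757015,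
  933928943774877764208929959911427505327807593582786750913371261015251848809171398388168296259,
  675319056865277994969724361140097693856732661484890134889523680596817329317406402528664497404,
  663255648389374768194521847550214270953826974551959960319663415824386397401202524872610055829,
  682544130081630443533149583035526256377285499278425982798064168009524084938337524429124300546,
  747831788221503756492980724180155408403277889948794746919345529059158091657298285925138320236,
  747930174626882548451472153503464801391091617792163313431142915664267273511555090359505645343,
  805611726568432823766674695214459379005594567905190283141677591282908645298321163824767888305,
  856115907498022731090329090547303124747776086194277953283660799065142727915076977042000785208,
  683007642072737066219648831358319527499744573716059192280866308710573755526884394354934336276,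
  742670526787138429805876643617459432245863459494838583129621242559423379167283400897153993819,
  741484919900874504285511765764208051461690473669867600925687221123093968829326959842651981534,
  683237588053370794872460988877674411887861588421143750516428073293817963517065891202520656897,
  855169046734069597695570597588280703766216696040976561381060276275415907639434466601388117840,
  922469993665738630894796503895530693824712943968977192988358329383408070415167205763521056258,
  683509005184475864271153892375901639693972056120585592050843044362597583388330251777880338300,
  747960058700859709643022196118377840511395259766656586485511349001593927979446130063322845067,
  748845112393796256548140638417380440399174099996459651511564839945401914023683236894522511254,
  879311161258265798557661817181945848890705600667622102001994195748987915282936446606724287438,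
  1058498729320860297224042284699378204006449616510838694625196546589698016146996947684421308330,
  683962619248708163017291276541542780410507843970241186791911053817784481950526986409780570027,
  804043042701827656796286300424676347751787825809175060985847691677422139433290388562840702917,
  605855036595666845118961745212452903394861884486219325570304182375169423731512823580283563980,
  863627623361161079693045381080925658785680927545884280709663660416507876064679782069234159571,
  928478581008249203073619753818420533319838550910781637165103492782375352104611539212732581421,
  804585426185200150532002676916265086865041816175147463715549205699162410555503379146281832418,
  590091913323780761315525480942766839510198628211678791231604114426240951091293865453438128108,
  749657091683847863245804547808980000634521098972220019013823757454728504339361810367343685622,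
  728745654924237494622503121818807102379214730901002817422579968059513917248454014887439388676,
  807505751851994005713986306706038039266696448407928898613254928868101450793260052150992620474,
  675822525796555891907989145434887319969330291613356936411681262198202453309313705430463205401,
  749989360913012391887471913573329603776050137491269665487175193461749432872348446136638083107,
  733058481821537209996466279485479942557566995402130977703098942003771450403367522583548643407,
  725069490142552379490532854523840711573825941030842329431795943231847789644198631822888210487,
  685044926776419198155653563915919075188930730235995286687835664258536865819442983049424810048,
  738373904629801066509686876155976255765648972406825503208887848484912674863601966147434450093,
  750379673233307106780405382152314640014542124802664256809391724605721739721694813729431244888,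
  735286538518874536029289073124698361935105566358871370705235472936450017722525606640916107359,
  804545771486939715931384824510872515224613567617345061106768668143690659691973787784719691881,
  741745916457701036183839254793595577438627519450714413948129410185135567675476828502740929894,
  879096525512154336116053620546978619716696073309525922781956602395028878975797267714051952761,
  681057705658535086885152726950318017515525599327525919746244121665027343570550690582610473087,
  912596235173459828632935431253667459836842775591699793413561687639641951012112480874154485355,
  750850813149223290177808212754742490494325985091199924717128017775730748300265874325383557264,
  750889280023104220347231960698041505991701817045720171193202476857931885147782772481640039735,
  737999997205749363739166026601518441106301900644071909649398170261702921393738737627576930463,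
  662987749614868079783462774715444116256021340236289027350247716667330755186925196200989977163,
  745002330715176653634028878763460911042247267337748598642942638006225404595231592927602053301,
  791432437810129503783386195485558848131076546361035799609111623028104668793397562944311185601,
  620957999336667031983346146518909530843928435340785809389788998981313908911175466145163194571,
  686230690095391042077439207961087661204652359181572804185493635727365561913133791801260740822,
  810434195109694920351041557973604506908913917945618072556999943906449203765404961008314675425,
  744676136240268556195276743620226762892743291860094121614742226148727238043671909338399477995,
  745517884017393314422048338798163068129022634738159550127269178380384946146426567895549577595,
  730782814248027667833628426596812849410657942740387784704183999852949652717729027332790763825,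
  922343895964492367687883782106610088609344134448779516210991843393108584902240959253845184775,
  810887804406109477573383874317624793965636749828125926016366293867159989243166584054925644049,
  752018405717309100444780538281893759943951462734064081331222474882348269158743965940362514719,
  621737897279848702694481882448456586976571832001503236636881337230973658386751723665796559149,
  686993147817249972715829837302920143435629037825518551237543467284773376297519557309190538775,
  687055764801284472933355552894666265934910926402323898193488339080151487819537130057290871105,
  803447898423503612821084190924987708304665505546523048324889533936573483687348126070387114341,
  882764995430515971588945393800843755990729294892178539003283258796276340660624586706894081400,
  752471686804432279322847005814254003256384576028688764957126318376773432755496846476425528301,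
  737942704986848036867125990079839439591212726910301319000716836781659894953575489833492345190,
  665088105855280726836692693871324452274376295478416955023938372137932631763409250916150325615,
  752672304181245460368525667294583191952742697031221936541540019632961533124747139040681062177,
  817906128022146444568379170214635732456099748227718970384678206613672616702247608389926392191,
  612475829915663916976726907996831516279512251513882995667863844323639373401122232276156984250,
  818049374665133583703344474900971292553791071058348564919750460656605594108636249256994360250,
  687798444356892796634852749846590904905519063354651164370583849351795598189912625139963597207,
  753079093317044853389287874968844900347684112169234813786839893711512209936237962965091141503,
  818351784074290430568583257788563963900039662165903249722683244758702515759416244986451972530,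
  688051002895744552536019191342569809768956371251268264844944524413833339585308490774977810877,
  688010721724193931323129201764688382280152549729364935296329782735560279681525074181093902774,
  678393111833458443557819888423355611910487321041930635577593547436575537819616793437947769291,
  753429251549723662535910651315780501557834271362617499224121114584365423473939690729105953235,
  688311485575781840056003206939968046021369385195103655091079350868744719609792652138822939102,
  805564660530074722298934374090735251503928759136667731929447025891079307320394814259060197611,
  1012610279964870821747339763649883629553232890064877673733966796214743475619097886737645315907,
  688538559286052891012071187450998156111688573971880820899142726124617463725320971704593410782,
  884250706774743971290160998866359368011376384581940558941808962512996232495366576456670990082,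
  601430675288409766956884041123369334133527685946499462760797402648119818540287369158454341513,
  747938341609767330212982793484593100896127461617727120094580432878042980054549743468485546394,
  942984243000836078526263828061009398274161730141284183621393625583363652530249125496690683692,
  623860227103359727081601070377278271789283748311824211205133938850509626754261151175854740025,
  679491057844413930488496724327140291022015401539632286772480660336168304587822553976971104101,
  749259807216505218341159503412206540249145390669487699397001066997139333427270397012478808646,
  797902005085254474388866189407289771634141892534905792607045318369505722495681735145246372434,
  819225648987719057919020676594154789394443620956898231609746699151162120648701475547091251801,
  753007652579048054049368317422569993232965830732818508209177290762085368330260494526863921759,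
  754574392686411494386290104788684954019049647933626884607235997660864249958649850196380124917,
  689476875221458447832235246238324348345959511692077055767262813847197103195941252085309698670,
  747921432676688342573688783654208383331592682476865354236287078358664034128704720045985444365,
  813145099212251926711123170611357326169545796566812106968745032620714404243625608164195472002,
  624513605906384102218183305519332956764018509003945160697134293680882354404848906335264297612,
  689811125964556359558109706642156503097695241293954596984549490929646364856906012060669891221,
  742735016628548593162712432663942744818484183742009112428166843470408476463978035748225331247,
  661663698281833166524286391845357565012585858665221881464419786516203828111349011575711355567,
  928366229729277387737863729678631687789471617754921005795816323360372419366777799585080279295,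
  677549885753592008123846613725077197098100644297788514420411278701885218028360076421389945095,
  872094787519385803502150946359220938718931181451514673926039963850324070746451228247213904580,
  861432184074835855483818032376206800680301222059155260796862000816461733850630160748183851725,
  690281384872517561204678923139741522129009982764687536896065134579758144267147727334840209389,
  814795221539623940865263814905690932130601603722000436901504175277545542153579801088994579166,
  800925884812424879011067557631933963981946665070474677493784337370784392487156755872638128874,
  685578728477240972680209358697312366564125965862993316810845011471120422502431471063448318712,
  947680016563099112516283350967232086337383889240094325714319240468832889325366074103866602238,
  993982807879189512958080036463610766367212940654673580023072481850329451121304038662142915333,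
  753070778556943946089008792798471879033189802070160804673326735565536793702906966958549856333,
  717041411867920447707029672492328337002835804042008611719191299235221304618225106470906467091,
  1081923760927745491232275878494582548430942010355885132256071025244834003554298898460677264153,
  880784108326669296619861117759434625502126318500754792499594525178023319334214696347783065700,
  612476242734098200291695785568819621356126678828612428762950537434911233513168157408357339945,
  883258808268233039915995550213234723141084986425554361453759597931142452932736146278787224371,
  868781365572344312887006852346706819884319570269223100003486508090634892567828070065851683645,
  750651717761994082592699864122581666072156783593484965061673739798129376883382723667340430694,
  815978979056213741499335438146191507546122463070119896467133911841831331569471450566083358913,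
  626098959737742597560014648687605974641679508355914792259369064125955922793792930162078763313,
  940359510857759941289985455963393180838684035094648448320819237385648391885833648334464322378,
  736104373957174845487107727341262594237618805951248007216190736966289870348874009553344467813,
  821861096075213308669774191242292270314747551994373096399642705658871287089605833490569409388,
  806169792204560913128350217783993838048277178596349410119032355458886962464597743606651687798,
  801912064163411273604701121823104585948526721720979675062430698167375581150154109444574622591,
  756880013397893619048776026938674032795561676365495315071307180448216222190140416190596525123,
  745949893696090682968180227160696868273606505333460576501366287963582132214804414921828938640,
  1006260864777977181371684875034733571096990244339675968478346554229908907041815079985085622143,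
  741565556271821836421080976179097549267544336119973182697821769684919374036787288885023118239,
  746243505750060537615360626831392807021080981738913468948095190794978325640992271813239967825,
  811031050958883257743390621843627217002027411472808981024502407347051391853306648396844895464,
  811210477856161586274610862451856161029697594358835062806797353705608331703446856983606850487,
  656006880568829038735292138856866439594693018563219963680514902511845717116610804989229003710,
  872531282828387769500288960427791839278792243828925029532637583700182058805359116400935373177,
  818080709816749575900041568877757336653031832139532068317777518550717448070106722015028122575,
  671749381462962511850334163386988313534210476680913916849027224065041175371694775555560599778,
  804080851944360254623781787170425240558387977416818744568779130603498701486010375046153621495,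
  948277029798946249826462676922575886744408873910336184501129300925897614912899276602007654810,
  757686266578288727629585048250037108926906123319361003982116218503696895132543443536907297372,
  627400716971654820163383803117219244087273411850624390905621116207001003976247884446389151439,
  942531979056250494592950411676009121195095600752747330038897631008392520451667542824908297216,
  1081439776030901429723393455197638310304282315763060136941277173786362091327340762713915167753,
  681193931457379163593954179105505198205369625271858730793168991780006862495435485022099133156,
  883911514784706766595531978619346087163117573849194460555572193055964833542380677522214686151,
  1007421420128160826918275230722189290680543553302407925132738259871371950573515339469705505193,
  758156388528929895213960743643735160065804722789188823912574228143933849590401175192345037885,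
  953782200906100380043686655622291254645516927496569403998048081249320178960997509208356553995,
  1007645571032343924893240570246091746886244581801804216666268589642639518996130635038260146617,
  1014352261447219074943776875625438129178683874233373121784767285894618807696626633285690676290,
  943860900506626313376535971208034035143882891058645129435022798568971141784408534289396184138,
  823707614449573882815300323139388448851240026800540478458781137574259666224324001589949771754,
  758616738990328464035469575538242786233975421896412384665538536381230192285038254380227408990,
  950314195989073116760313582282810469802746921184665257769189656397817866901378075237563584387,
  889128254897141475217882395786107542048457458409079704116960089764154144546232728162765567091,
  722914159273568808880040020841758628894697020619797784939769866494150439341869809037254571132,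
  693726817984949333358693734499444881120093633243740047241495542952031306242010164764207010480,
  743331122631621326688841531381242588315022162982170100804989941823736075655552078782461145553,
  945165949471141389758751611884050631990857611436167499055005234213696366177825683983825917077,
  1015499397740874977373822183256306414574999586838278878339072593469884431707102008584406742176,
  745949283668723287550823211974825991772559129703468645678580206889739597277378561720306734247,
  782224568968780136799235053460612546969696927689807168258398060925111173677103724454447936684,
  807156223057539761599095093846127765702206131945387925807946975006117906238104436205501904053,
  683749018954883093479975356587639504539328082028154940550073439607639358776832915894232806585,
  939842644343830052072568596272390112984236232051297419341804902576669625116627905011700822122,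
  694251436697117479091200938827769409664928619175067206012534111005090637051260192342280795340,
  746244665529531230375870408312419299405426486716900861251744463892093964421753227477740383530,
  946661959017543252516885734107192536557144342518190594304223398345852706119675496388512499233,
  756849974760005647993494877029403102573549719934084336085673655734538704203238980900797625567,
  694507158872175169427581883857931730924325136782211007018963027158328870859174129857051029862,
  1017806727896243867940441218969294487031269205546631506476828794141787878349607008725277267185,
  890174026677278070964270086012759118837509074383026473112300870207214193485741698198787084815,
  694666019691082269952002863758680727353436817667446790000316654842193826148089268733459853728,
  1020662318070003294444615837075512658432854934214188315358431970728884746286086300818964747525,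
  1013709141004418578577955611535688124966465628725495334336520837766509063602500727496240263823,
  665551055435543127920363671627955322163464050157837057672575425949777465765203376625642599011,
  955674280697876853087975168217224720241142236711612691410024610103595492235674636498193598167,
  629807203799963071506376967460280834330707808262423256978160145252489573131468396923000775551,
  1014910708787281231457184377583524059614955126963093913412962696933725573720242999723844555822,
  815193662980749964720141082775386381641363694434431423449979748483379178955292711841088475860,
  1021172995273323945431959873671171604711944620337602402813913294814744721450831397677256774978,
  818209450645323700579424266119179426325990412130471957049330856527421120462843312374423342979,
  808516273869974184561089504403588210100857168852125983827831375013318150073216211750274397526,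
  1017982216101419526993582192692132344877425846852180238326398518095118606307963927050923921665,
  825824480403004594780928584807539690448018222366294335152821866126698215820578622913517073620,
  754989744054761411057608591608634703909436289972021324595717549823256262929344908292765255178,
  952391265484107856273283321762729783597513610880682258522391348582667370092350944581628851566,
  675823855588840060920011933832949630097005089562053122545398572366394118905631951568210130290,
  956409378836360619503865747298068953253849480105335753474928165325401205873422037361956148604,
  654840808107600504474357195999109370895181110843810693509328189748091387311376887649309585399,
  761029278233924240346232846275789232812537812212535725877869662024835453023041215959424669067,
  890850545519008061620632162508459099178314019346619565099573959262450398186747963511284217241,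
  852955391058092478076804543146564880795433861715080802999568855833367803776201425258074672249,
  1017576312794468040311684651291468568841611693431661404291082481233743532927302786205875508647,
  891105196399751094935557036368766226720704753892340829926744926327932517485654207129394771375,
  956891728011092193824267787454638217707829656926958868828244113224684139590407548686933890009,
  1020098791614004914325752764333242076142319021986393732767016386343254116584091065112937895313,
  753143777274313736995721039511034183568487301951929799954328988165039733664626125593636771274,
  761553625016822659978247757098557903223126437146649592386030719875049526028530341554306042881,
  782223958152233289704610047484768531104805766917862533174729932844965774382590002621116773851,
  1087392759607611340923370700990231458049620981359291714627550426763062345309573009252860294570,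
  576460753422954655]

def zeroSumPositions : List ℕ :=
  [10, 18, 37, 0, 19, 38, 8, 27, 46, 65, 35, 54, 73, 62, 81, 9, 28, 17,
  36, 55, 74, 44, 63, 82, 52, 71, 90, 109, 98, 45, 64, 53, 72, 91, 61, 80, 99,
  118, 88, 107, 126]

/-! ### Bit vectors of nodes

A finite set of nodes is stored as a natural number. For every vector `vecPos` is the position of
its bit in a block of 370 bits, and block number `i < 7` stands for one condition on the run,
listed in `planesAbove`. The functions below are written with recursors and with the operations
that the kernel evaluates on binary numerals. -/

/-- The position of a vector with coordinates between `-2` and `2` in the bit mask `vecMask`. -/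
def vecCode (x : Vec) : ℕ :=
  (((x.1 + 2) * 125 + (x.2.1 + 2) * 25 + (x.2.2.1 + 2) * 5 + (x.2.2.2 + 2))).toNat

def smallInts : List ℤ := [-2, -1, 0, 1, 2]

def inBox (x : Vec) : Bool :=
  and (Nat.ble x.1.natAbs 2) <| and (Nat.ble x.2.1.natAbs 2) <|
    and (Nat.ble x.2.2.1.natAbs 2) (Nat.ble x.2.2.2.natAbs 2)

/-- The vectors kept in the search: no word of digits leads from any other one to sum zero. -/
def isLive (x : Vec) : Bool := inBox x && vecMask.testBit (vecCode x)

def runs : List ℤ := [-3, -2, -1, 0, 1, 2, 3]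

/-- The search behind `deadVec`. Coordinates are shifted by `100` and the run by `3`. -/
noncomputable def deadNat (n : ℕ) : ℕ → ℕ → ℕ → ℕ → ℕ → Bool :=
  Nat.rec (motive := fun _ => ℕ → ℕ → ℕ → ℕ → ℕ → Bool) (fun _ _ _ _ _ => false)
    (fun _ r a b c d t =>
      (fun s =>
        and (not (Nat.beq s 400)) <|
        or (and (Nat.ble 101 a) (and (Nat.ble 101 b) (and (Nat.ble 101 c) (Nat.ble 101 d)))) <|
        or (and (Nat.ble a 99) (and (Nat.ble b 99) (and (Nat.ble c 99) (Nat.ble d 99)))) <|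
        and (Nat.ble 302 s) <|
        and (r (Nat.sub s 300) a b c 3) <|
        and (r (Nat.sub s 301) a b c 3) <|
        and (or (Nat.beq t 6) (r (Nat.sub s 299) a b c (Nat.add (Nat.sub t 3) 4)))
          (or (Nat.beq t 0) (r (Nat.sub s 302) a b c (Nat.sub (Nat.sub t (Nat.sub t 3)) 1))))
      (Nat.add (Nat.add a b) (Nat.add c d))) n

def shifted (x : ℤ) : ℕ := (x + 100).toNat

/-- A sufficient criterion for `(v, s)` not to lead to a vector of sum zero, whatever `s` is. -/
noncomputable def deadVec (v : Vec) : Bool :=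
  deadNat 9 (shifted v.1) (shifted v.2.1) (shifted v.2.2.1) (shifted v.2.2.2) 3

def bitSet (l : List ℕ) : ℕ := l.foldr (fun p acc => 1 <<< p ||| acc) 0

def vecPos (x : Vec) : ℕ := (67 * x.1 + 58 * x.2.1 + 50 * x.2.2.1 + 31 * x.2.2.2 + 181).toNat

/-- The blocks in which a node has a bit, for the runs `-3, …, 3`: a run stands for itself and all
runs that allow fewer continuations. -/
def planesAbove : List (List ℕ) :=
  [[6], [5, 6], [4, 5, 6], [0, 1, 2, 3, 4, 5, 6], [1, 2, 3], [2, 3], [3]]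

def planeMasks : List ℕ := planesAbove.map fun l => bitSet (l.map (370 * ·))

def planeMask (s : ℤ) : ℕ := planeMasks.getD (s + 3).toNat 0

def nodeBits (q : Node) : ℕ := if isLive q.1 then planeMask q.2 <<< vecPos q.1 else 0

def planeUnit : ℕ := planeMask 0

def coordMask (k a : ℕ) : ℕ := (coordMasks.getD k []).getD a 0 * planeUnit

noncomputable def spread (k s x : ℕ) : ℕ :=
  Nat.lor (Nat.shiftRight (Nat.land x (coordMask k 0)) (Nat.mul 2 s)) <|
  Nat.lor (Nat.shiftRight (Nat.land x (coordMask k 1)) s) <|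
  Nat.lor (Nat.land x (coordMask k 2)) <|
  Nat.lor (Nat.shiftLeft (Nat.land x (coordMask k 3)) s)
  (Nat.shiftLeft (Nat.land x (coordMask k 4)) (Nat.mul 2 s))

/-- Moves the bit of every vector `v` to that of `shiftAdd v 0`, one coordinate at a time. -/
noncomputable def shiftCoords (x : ℕ) : ℕ := spread 3 36 (spread 2 48 (spread 1 59 (spread 0 58 x)))

def fullMask : ℕ := shiftMasks.foldr (· ||| ·) 0

noncomputable def joinPlanes (x : ℕ) : ℕ :=
  Nat.lor x (Nat.shiftLeft (Nat.land (Nat.lor (Nat.shiftRight x (Nat.mul 3 370))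
    (Nat.shiftRight x (Nat.mul 6 370))) fullMask) (Nat.mul 7 370))

def planeShiftMask (src i : ℕ) : ℕ := shiftMasks.getD i 0 <<< (370 * src)

noncomputable def moveUp (x src i k : ℕ) : ℕ :=
  Nat.shiftLeft (Nat.land x (planeShiftMask src i)) k

noncomputable def moveDown (x src i k : ℕ) : ℕ :=
  Nat.shiftRight (Nat.land x (planeShiftMask src i)) k

noncomputable def commonStep (x : ℕ) : ℕ := joinPlanes (shiftCoords x)

/-- `d` is a digit. -/
noncomputable def digitMove (d x : ℕ) : ℕ :=
  Nat.lor (moveDown x 7 (2 - d) (370 * 7 + 67 * d)) <|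
  Nat.lor (moveDown x 7 (2 - d) (370 * 6 + 67 * d)) <|
  Nat.lor (moveDown x 7 (2 - d) (370 * 5 + 67 * d)) <|
  Nat.lor (moveDown x 7 (2 - d) (370 * 4 + 67 * d)) <|
  Nat.lor (moveDown x 7 (2 - d) (370 * 3 + 67 * d)) <|
  Nat.lor (moveDown x 7 (2 - d) (370 * 2 + 67 * d)) <|
  Nat.lor (moveDown x 7 (2 - d) (370 * 1 + 67 * d)) <|
  Nat.lor (moveDown x 6 (3 - d) (370 * 5 - 67 * (1 - d))) <|
  Nat.lor (moveDown x 6 (3 - d) (370 * 4 - 67 * (1 - d))) <|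
  Nat.lor (moveDown x 6 (3 - d) (370 * 3 - 67 * (1 - d))) <|
  Nat.lor (moveUp x 1 (3 - d) (370 + 67 * (1 - d))) <|
  Nat.lor (moveUp x 2 (3 - d) (370 + 67 * (1 - d))) <|
  Nat.lor (moveUp x 3 (1 - d) (370 * 1 - 67 * (1 + d))) <|
  Nat.lor (moveUp x 3 (1 - d) (370 * 2 - 67 * (1 + d))) <|
  Nat.lor (moveUp x 3 (1 - d) (370 * 3 - 67 * (1 + d))) <|
  Nat.lor (moveUp x 4 (1 - d) (370 - 67 * (1 + d)))
  (moveUp x 5 (1 - d) (370 - 67 * (1 + d)))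

/-- The bit vector of the successors of the nodes in `x`. -/
noncomputable def digitStep (d : Bool) (x : ℕ) : ℕ := digitMove d.toNat (commonStep x)

def startBits : ℕ := planeUnit <<< 181

/-- The vectors of sum zero among those of the nodes in `x`. -/
noncomputable def outputBits (x : ℕ) : ℕ :=
  Nat.land (Nat.lor (Nat.shiftRight x 1228) (Nat.shiftRight x 2338)) (bitSet zeroSumPositions)

def boxVecs : List Vec :=
  smallInts.flatMap fun a => smallInts.flatMap fun b => smallInts.flatMap fun c =>
    smallInts.map fun d => (a, b, c, d)

noncomputable def nodeCheck (q : Node) (d : Bool) : Bool :=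
  Nat.beq (digitStep d (nodeBits q)) (((nodeSucc d q).map nodeBits).foldr (· ||| ·) 0)

noncomputable def allNodesCheck : Bool :=
  boxVecs.all fun v => !isLive v || runs.all fun s => nodeCheck (v, s) false && nodeCheck (v, s) true

def liveVecs : List Vec := boxVecs.filter fun v => isLive v

noncomputable def boundaryCheck : Bool :=
  liveVecs.all fun v => [-2, -1, 0, 1].all fun c => isLive (shiftAdd v c) || deadVec (shiftAdd v c)

noncomputable def outCheck : Bool :=
  boxVecs.all fun v => !isLive v || runs.all fun s =>
    Nat.beq (outputBits (nodeBits (v, s))) (if vecSum v = 0 then 1 <<< (vecPos v - 118) else 0)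

noncomputable def packBlocks (w : ℕ) (l : List ℕ) : ℕ :=
  List.rec (motive := fun _ => ℕ) 0 (fun a _ r => Nat.add a (Nat.shiftLeft r w)) l

noncomputable def rowTable : ℕ := packBlocks 310 rowBlocks

/-- Row `i` of the transition table: the two successors of label `i` and its output. -/
noncomputable def row (i : ℕ) : ℕ := Nat.land (Nat.shiftRight rowTable (Nat.mul 31 i)) 2147483647

/-- Binary tries that store lists of numbers by the low bits of a key. -/
inductive Trie where
  | leaf (l : List ℕ)
  | node (l r : Trie)

/-- Evaluates `x` before it is substituted. -/
noncomputable def force {α : Type} (x : ℕ) (k : ℕ → α) : α :=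
  Nat.rec (motive := fun _ => α) (k 0) (fun n _ => k (Nat.succ n)) x

noncomputable def Trie.full (n : ℕ) : Trie :=
  Nat.rec (motive := fun _ => Trie) (.leaf []) (fun _ t => .node t t) n

noncomputable def listMem (x : ℕ) (l : List ℕ) : Bool :=
  List.rec (motive := fun _ => Bool) false (fun a _ r => Bool.rec r true (Nat.beq x a)) l

noncomputable def Trie.mem (x : ℕ) (t : Trie) : ℕ → Bool :=
  Trie.rec (motive := fun _ => ℕ → Bool) (fun l _ => listMem x l)
    (fun _ _ a b k => Bool.rec (b (Nat.div k 2)) (a (Nat.div k 2)) (Nat.beq (Nat.mod k 2) 0)) t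

noncomputable def Trie.add (x : ℕ) (t : Trie) : ℕ → Trie :=
  Trie.rec (motive := fun _ => ℕ → Trie) (fun l _ => .leaf (x :: l))
    (fun l r a b k =>
      Bool.rec (.node l (b (Nat.div k 2))) (.node (a (Nat.div k 2)) r) (Nat.beq (Nat.mod k 2) 0)) t

/-- The state of a graph search: visited states, states to be visited, and a success flag. -/
structure Search where
  seen : Trie
  work : List ℕ
  ok : Bool

noncomputable def bitCount (x : ℕ) (l : List ℕ) : ℕ :=
  List.rec (motive := fun _ => ℕ) 0 (fun p _ r => Nat.add (Nat.land (Nat.shiftRight x p) 1) r) l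

/-- Combines a bit vector, the length of the current run of ones, and a label. -/
noncomputable def packState (S t i : ℕ) : ℕ :=
  Nat.add (Nat.shiftLeft S 15) (Nat.add (Nat.shiftLeft t 13) i)

noncomputable def pushChildren (S t r : ℕ) (work : List ℕ) : List ℕ :=
  (fun y =>
    (fun c w => Bool.rec
      (c :: packState (digitMove 1 y) (Nat.succ t) (Nat.land (Nat.shiftRight r 13) 8191) :: w)
      (c :: w) (Nat.beq t 3))
    (packState (digitMove 0 y) 0 (Nat.land r 8191)) work)
  (commonStep S)

/-- The number of vectors of sum zero is the output in the row `r`. -/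
noncomputable def outputOk (S r : ℕ) : Bool :=
  force (outputBits S) fun y => Nat.beq (bitCount y zeroSumPositions) (Nat.shiftRight r 26)

noncomputable def visitNew (x : ℕ) (seen : Trie) (work : List ℕ) (S r : ℕ) : Search :=
  Bool.rec ⟨seen, [], false⟩
    ⟨Trie.add x seen x, pushChildren S (Nat.land (Nat.shiftRight x 13) 3) r work, true⟩
    (outputOk S r)

noncomputable def visit (σ : Search) : Search :=
  Search.rec (motive := fun _ => Search) (fun seen work ok =>
    List.rec (motive := fun _ => Search) ⟨seen, [], ok⟩
      (fun x work _ => force x fun x => Bool.rec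
        (visitNew x seen work (Nat.shiftRight x 15) (row (Nat.land x 8191)))
        ⟨seen, work, ok⟩
        (Trie.mem x seen x)) work) σ

/-- The iterate of order `2 ^ n`. -/
noncomputable def iterate2 (f : Search → Search) (n : ℕ) : Search → Search :=
  Nat.rec (motive := fun _ => Search → Search) f
    (fun _ r σ => Search.rec (motive := fun _ => Search)
      (fun seen work ok => r ⟨seen, work, ok⟩) (r σ)) n

noncomputable def isDone (σ : Search) : Bool :=
  Search.rec (motive := fun _ => Bool)
    (fun _ work ok => List.rec (motive := fun _ => Bool) ok (fun _ _ _ => false) work) σ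

/-- The bit vector of the nodes that are reached by leading zeros. -/
noncomputable def zeroBits : ℕ :=
  Nat.rec (motive := fun _ => ℕ) startBits (fun _ s => digitStep false s) 5

noncomputable def searchState (k : ℕ) : Search :=
  iterate2 visit k ⟨Trie.full 13, [packState (digitStep true zeroBits) 1 0], true⟩

/-! ### Checks -/

theorem boundaryCheck_eq : boundaryCheck = true := by decide +kernel

theorem allNodesCheck_eq : allNodesCheck = true := by decide +kernel

theorem outCheck_eq : outCheck = true := by decide +kernel

theorem digitStep_zeroBits : digitStep false zeroBits = zeroBits :=
  Nat.eq_of_beq_eq_true (by decide +kernel)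

theorem map_vecPos_zeroSum :
    (liveVecs.filter fun v => decide (vecSum v = 0)).map (fun v => vecPos v - 118) =
      zeroSumPositions := by decide +kernel

theorem isDone_searchState : isDone (searchState 15) = true := by decide +kernel

/-! ### Nodes that cannot lead to a vector of sum zero -/

inductive Alive : Node → Prop
  | of_vecSum_eq_zero {q : Node} (h : vecSum q.1 = 0) : Alive q
  | of_succ {q r : Node} (d : Bool) (h : r ∈ nodeSucc d q) (hr : Alive r) : Alive q

theorem exists_digit_of_mem_nodeSucc {d : Bool} {q r : Node} (h : r ∈ nodeSucc d q) :
    ∃ c : ℤ, -2 ≤ c ∧ c ≤ 1 ∧ r.1 = shiftAdd q.1 c ∧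
      (c = 1 → q.2 < 3 ∧ r.2 = max q.2 0 + 1) ∧ (c = -2 → -3 < q.2 ∧ r.2 = min q.2 0 - 1) := by
  rcases mem_nodeSucc.1 h with rfl | ⟨hq, rfl⟩ | ⟨hq, rfl⟩ <;>
    refine ⟨_, ?_, ?_, rfl, ?_, ?_⟩ <;> cases d <;> simp_all [digitVal]

theorem not_alive_of_pos {q : Node}
    (h : 1 ≤ q.1.1 ∧ 1 ≤ q.1.2.1 ∧ 1 ≤ q.1.2.2.1 ∧ 1 ≤ q.1.2.2.2) : ¬ Alive q := by
  intro hq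
  induction hq with
  | of_vecSum_eq_zero h0 => unfold vecSum at h0; omega
  | of_succ d hr _ ih =>
    obtain ⟨c, hc, -, hr, -⟩ := exists_digit_of_mem_nodeSucc hr
    apply ih
    simp only [hr, shiftAdd]
    omega

theorem not_alive_of_neg {q : Node}
    (h : q.1.1 ≤ -1 ∧ q.1.2.1 ≤ -1 ∧ q.1.2.2.1 ≤ -1 ∧ q.1.2.2.2 ≤ -1) : ¬ Alive q := by
  intro hq
  induction hq with
  | of_vecSum_eq_zero h0 => unfold vecSum at h0; omega
  | of_succ d hr _ ih =>
    obtain ⟨c, -, hc, hr, -⟩ := exists_digit_of_mem_nodeSucc hr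
    apply ih
    simp only [hr, shiftAdd]
    omega

theorem deadNat_succ_eq_true {n a b c d t s : ℕ} (hs : a + b + (c + d) = s) :
    deadNat (n + 1) a b c d t = true ↔ s ≠ 400 ∧
      ((101 ≤ a ∧ 101 ≤ b ∧ 101 ≤ c ∧ 101 ≤ d) ∨ (a ≤ 99 ∧ b ≤ 99 ∧ c ≤ 99 ∧ d ≤ 99) ∨
        (302 ≤ s ∧ deadNat n (s - 300) a b c 3 = true ∧ deadNat n (s - 301) a b c 3 = true ∧
          (t = 6 ∨ deadNat n (s - 299) a b c (t - 3 + 4) = true) ∧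
          (t = 0 ∨ deadNat n (s - 302) a b c (t - (t - 3) - 1) = true))) := by
  subst hs
  rw [ne_eq, ← Nat.beq_eq, ← Nat.beq_eq (x := t) (y := 6), ← Nat.beq_eq (x := t) (y := 0)]
  simp only [← Nat.ble_eq, ← Bool.and_eq_true, ← Bool.or_eq_true]
  rw [Bool.not_eq_true, ← Bool.not_eq_true', ← Bool.and_eq_true]
  rfl

theorem not_alive_of_deadNat {n A B C D T : ℕ} {a b c d : ℤ} (h : deadNat n A B C D T = true)
    (hA : (A : ℤ) = a + 100) (hB : (B : ℤ) = b + 100) (hC : (C : ℤ) = c + 100)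
    (hD : (D : ℤ) = d + 100) {s : ℤ} (hs : (T : ℤ) - 3 ≤ max s 0) (hs' : min s 0 ≤ (T : ℤ) - 3) :
    ¬ Alive ((a, b, c, d), s) := by
  induction n generalizing A B C D T a b c d s with
  | zero => simp [deadNat] at h
  | succ n ih =>
    intro halive
    obtain ⟨hne, h | h | ⟨h2, h0, h1, h3, h4⟩⟩ := (deadNat_succ_eq_true rfl).1 h
    · exact not_alive_of_pos (by dsimp only; omega) halive
    · exact not_alive_of_neg (by dsimp only; omega) halive
    · cases halive with
      | of_vecSum_eq_zero hsum => simp only [vecSum] at hsum; omega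
      | @of_succ _ r e hr hr' =>
        obtain ⟨g, hg, hg', hrg, hup, hdown⟩ := exists_digit_of_mem_nodeSucc hr
        obtain ⟨r, s'⟩ := r
        simp only [shiftAdd] at hrg hup hdown
        subst hrg
        obtain rfl | rfl | rfl | rfl : g = -2 ∨ g = -1 ∨ g = 0 ∨ g = 1 := by omega
        · obtain ⟨h5, rfl⟩ := hdown rfl
          exact ih (h4.resolve_left (by omega)) (by omega) hA hB hC (by omega) (by omega) hr'
        · exact ih h1 (by omega) hA hB hC (by simp) (by simp) hr'
        · exact ih h0 (by omega) hA hB hC (by simp) (by simp) hr'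
        · obtain ⟨h5, rfl⟩ := hup rfl
          exact ih (h3.resolve_left (by omega)) (by omega) hA hB hC (by omega) (by omega) hr'

theorem not_alive_of_deadVec {v : Vec} (hv : deadVec v = true)
    (hbox : ∀ x ∈ [v.1, v.2.1, v.2.2.1, v.2.2.2], -100 ≤ x) (s : ℤ) : ¬ Alive (v, s) := by
  simp only [List.forall_mem_cons] at hbox
  exact not_alive_of_deadNat hv (Int.toNat_of_nonneg (by omega)) (Int.toNat_of_nonneg (by omega))
    (Int.toNat_of_nonneg (by omega)) (Int.toNat_of_nonneg (by omega)) (by simp) (by simp)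

/-! ### Bit vector representation of the reachable nodes -/

theorem mem_smallInts {a : ℤ} (h : a.natAbs ≤ 2) : a ∈ smallInts := by
  have : a = -2 ∨ a = -1 ∨ a = 0 ∨ a = 1 ∨ a = 2 := by omega
  simpa [smallInts] using this

theorem inBox_iff {v : Vec} : inBox v = true ↔
    v.1.natAbs ≤ 2 ∧ v.2.1.natAbs ≤ 2 ∧ v.2.2.1.natAbs ≤ 2 ∧ v.2.2.2.natAbs ≤ 2 := by
  simp [inBox]

theorem inBox_of_isLive {v : Vec} (h : isLive v = true) : inBox v = true := by
  simp_all [isLive]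

theorem mem_boxVecs {v : Vec} (h : inBox v = true) : v ∈ boxVecs := by
  obtain ⟨h1, h2, h3, h4⟩ := inBox_iff.1 h
  simp only [boxVecs, List.mem_flatMap, List.mem_map]
  exact ⟨_, mem_smallInts h1, _, mem_smallInts h2, _, mem_smallInts h3, _, mem_smallInts h4, rfl⟩

theorem mem_liveVecs {v : Vec} (h : isLive v = true) : v ∈ liveVecs :=
  List.mem_filter.2 ⟨mem_boxVecs (inBox_of_isLive h), h⟩

theorem mem_runs {s : ℤ} : s ∈ runs ↔ -3 ≤ s ∧ s ≤ 3 := by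
  simp only [runs, List.mem_cons, List.not_mem_nil, or_false]
  omega

theorem isLive_shiftAdd {v : Vec} (hv : isLive v = true) {c s : ℤ} (hc : -2 ≤ c) (hc' : c ≤ 1)
    (h : Alive (shiftAdd v c, s)) : isLive (shiftAdd v c) = true := by
  have hmem : c ∈ ([-2, -1, 0, 1] : List ℤ) := by
    have : c = -2 ∨ c = -1 ∨ c = 0 ∨ c = 1 := by omega
    simpa using this
  have := boundaryCheck_eq
  rw [boundaryCheck, List.all_eq_true] at this
  have := List.all_eq_true.1 (this v (mem_liveVecs hv)) c hmem
  refine (Bool.or_eq_true_iff.1 this).resolve_right fun hdead => not_alive_of_deadVec hdead ?_ s h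
  have := inBox_iff.1 (inBox_of_isLive hv)
  simp only [shiftAdd, List.forall_mem_cons]
  refine ⟨?_, ?_, ?_, ?_, by simp⟩ <;> omega

def liveSucc (d : Bool) (q : Node) : List Node := (nodeSucc d q).filter fun r => isLive r.1

def liveReach : List Bool → List Node
  | [] => [(0, 0)]
  | d :: D => (liveReach D).flatMap (liveSucc d)

theorem run_mem_runs {d : Bool} {q r : Node} (hq : q.2 ∈ runs) (hr : r ∈ nodeSucc d q) :
    r.2 ∈ runs := by
  rw [mem_runs] at hq ⊢
  rcases mem_nodeSucc.1 hr with rfl | ⟨h, rfl⟩ | ⟨h, rfl⟩ <;> dsimp only <;> omega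

theorem isLive_and_mem_runs {D : List Bool} {q : Node} (h : q ∈ liveReach D) :
    isLive q.1 = true ∧ q.2 ∈ runs := by
  induction D generalizing q with
  | nil =>
    obtain rfl : q = (0, 0) := by simpa [liveReach] using h
    exact ⟨by decide +kernel, by simp [runs]⟩
  | cons d D ih =>
    obtain ⟨r, hr, hq⟩ := List.mem_flatMap.1 h
    rw [liveSucc, List.mem_filter] at hq
    exact ⟨hq.2, run_mem_runs (ih hr).2 hq.1⟩

theorem mem_liveReach_of_alive {D : List Bool} {q : Node} (h : q ∈ reach D) (hq : Alive q) :
    q ∈ liveReach D := by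
  induction D generalizing q with
  | nil => exact h
  | cons d D ih =>
    obtain ⟨r, hr, hqr⟩ := List.mem_flatMap.1 h
    have hr := ih hr (.of_succ d hqr hq)
    refine List.mem_flatMap.2 ⟨r, hr, List.mem_filter.2 ⟨hqr, ?_⟩⟩
    obtain ⟨c, hc, hc', heq, -⟩ := exists_digit_of_mem_nodeSucc hqr
    obtain ⟨q, s⟩ := q
    simp only at heq
    subst heq
    exact isLive_shiftAdd (isLive_and_mem_runs hr).1 hc hc' hq

theorem mem_reach_of_mem_liveReach {D : List Bool} {q : Node} (h : q ∈ liveReach D) :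
    q ∈ reach D := by
  induction D generalizing q with
  | nil => exact h
  | cons d D ih =>
    obtain ⟨r, hr, hq⟩ := List.mem_flatMap.1 h
    exact List.mem_flatMap.2 ⟨r, ih hr, (List.mem_filter.1 hq).1⟩

theorem mem_liveReach_iff {D : List Bool} {q : Node} (hq : vecSum q.1 = 0) :
    q ∈ liveReach D ↔ q ∈ reach D :=
  ⟨mem_reach_of_mem_liveReach, fun h => mem_liveReach_of_alive h (.of_vecSum_eq_zero hq)⟩

/-- A map on bit vectors that preserves unions. -/
structure IsUnionHom (f : ℕ → ℕ) : Prop where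
  map_zero : f 0 = 0
  map_or : ∀ x y, f (x ||| y) = f x ||| f y

namespace IsUnionHom

theorem id : IsUnionHom fun x => x := ⟨rfl, fun _ _ => rfl⟩

theorem or {f g : ℕ → ℕ} (hf : IsUnionHom f) (hg : IsUnionHom g) :
    IsUnionHom fun x => Nat.lor (f x) (g x) := by
  refine ⟨by simp [hf.map_zero, hg.map_zero], fun x y => ?_⟩
  rw [hf.map_or, hg.map_or]
  change f x ||| f y ||| (g x ||| g y) = f x ||| g x ||| (f y ||| g y)
  ac_rfl

theorem and {f : ℕ → ℕ} (hf : IsUnionHom f) (m : ℕ) : IsUnionHom fun x => Nat.land (f x) m := by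
  refine ⟨by simp [hf.map_zero], fun x y => ?_⟩
  rw [hf.map_or]
  exact Nat.and_or_distrib_right ..

theorem shiftLeft {f : ℕ → ℕ} (hf : IsUnionHom f) (k : ℕ) :
    IsUnionHom fun x => Nat.shiftLeft (f x) k := by
  refine ⟨by simp [hf.map_zero], fun x y => ?_⟩
  rw [hf.map_or]
  exact Nat.shiftLeft_or_distrib ..

theorem shiftRight {f : ℕ → ℕ} (hf : IsUnionHom f) (k : ℕ) :
    IsUnionHom fun x => Nat.shiftRight (f x) k := by
  refine ⟨by simp [hf.map_zero], fun x y => ?_⟩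
  rw [hf.map_or]
  exact Nat.shiftRight_or_distrib ..

theorem comp {f g : ℕ → ℕ} (hf : IsUnionHom f) (hg : IsUnionHom g) :
    IsUnionHom fun x => f (g x) :=
  ⟨by rw [hg.map_zero, hf.map_zero], fun x y => by rw [hg.map_or, hf.map_or]⟩

theorem map_foldr {f : ℕ → ℕ} (hf : IsUnionHom f) {α : Type*} (g : α → ℕ) (l : List α) :
    f (l.foldr (g · ||| ·) 0) = l.foldr (fun a r => f (g a) ||| r) 0 := by
  induction l with
  | nil => exact hf.map_zero
  | cons a l ih => rw [List.foldr_cons, hf.map_or, ih, List.foldr_cons]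

end IsUnionHom

theorem isUnionHom_spread (k s : ℕ) : IsUnionHom (spread k s) :=
  ((IsUnionHom.id.and _).shiftRight _).or <| ((IsUnionHom.id.and _).shiftRight _).or <|
    (IsUnionHom.id.and _).or <| ((IsUnionHom.id.and _).shiftLeft _).or <|
    (IsUnionHom.id.and _).shiftLeft _

theorem isUnionHom_commonStep : IsUnionHom commonStep := by
  have h : IsUnionHom joinPlanes :=
    IsUnionHom.id.or <| (((IsUnionHom.id.shiftRight _).or (IsUnionHom.id.shiftRight _)).and _).shiftLeft _
  exact h.comp <| (isUnionHom_spread _ _).comp <| (isUnionHom_spread _ _).comp <|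
    (isUnionHom_spread _ _).comp <| isUnionHom_spread _ _

theorem isUnionHom_digitMove (d : ℕ) : IsUnionHom (digitMove d) := by
  have hup (a b c : ℕ) : IsUnionHom (moveUp · a b c) := (IsUnionHom.id.and _).shiftLeft _
  have hdown (a b c : ℕ) : IsUnionHom (moveDown · a b c) := (IsUnionHom.id.and _).shiftRight _
  unfold digitMove
  repeat' first | exact hup _ _ _ | exact hdown _ _ _ | apply IsUnionHom.or

theorem isUnionHom_digitStep (d : Bool) : IsUnionHom (digitStep d) :=
  (isUnionHom_digitMove _).comp isUnionHom_commonStep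

theorem isUnionHom_outputBits : IsUnionHom outputBits :=
  ((IsUnionHom.id.shiftRight _).or (IsUnionHom.id.shiftRight _)).and _

/-- The union of the bit vectors of the nodes in a list. -/
def unionBits (l : List Node) : ℕ := l.foldr (nodeBits · ||| ·) 0

theorem unionBits_append (l l' : List Node) :
    unionBits (l ++ l') = unionBits l ||| unionBits l' := by
  induction l with
  | nil => simp [unionBits]
  | cons q l ih =>
    simp only [unionBits, List.cons_append, List.foldr_cons] at ih ⊢
    rw [ih, Nat.or_assoc]

theorem unionBits_liveSucc (d : Bool) (q : Node) :
    unionBits (liveSucc d q) = unionBits (nodeSucc d q) := by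
  unfold liveSucc
  induction nodeSucc d q with
  | nil => rfl
  | cons r l ih =>
    by_cases hr : isLive r.1 = true
    · rw [List.filter_cons_of_pos (p := fun r : Node => isLive r.1) hr]
      exact congrArg (nodeBits r ||| ·) ih
    · rw [List.filter_cons_of_neg (p := fun r : Node => isLive r.1) hr, ih]
      simp [unionBits, nodeBits, hr]

theorem digitStep_nodeBits (d : Bool) {q : Node} (hq : isLive q.1 = true) (hs : q.2 ∈ runs) :
    digitStep d (nodeBits q) = unionBits (liveSucc d q) := by
  have h := List.all_eq_true.1 allNodesCheck_eq q.1 (mem_boxVecs (inBox_of_isLive hq))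
  rw [hq, Bool.not_true, Bool.false_or] at h
  have h := Bool.and_eq_true_iff.1 (List.all_eq_true.1 h q.2 hs)
  rw [unionBits_liveSucc, unionBits, ← List.foldr_map]
  cases d
  · exact Nat.eq_of_beq_eq_true h.1
  · exact Nat.eq_of_beq_eq_true h.2

noncomputable def stateBits (D : List Bool) : ℕ := D.foldr digitStep startBits

theorem stateBits_eq (D : List Bool) : stateBits D = unionBits (liveReach D) := by
  induction D with
  | nil => decide +kernel
  | cons d D ih =>
    have h : ∀ l : List Node, (∀ q ∈ l, isLive q.1 = true ∧ q.2 ∈ runs) →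
        l.foldr (fun q r => digitStep d (nodeBits q) ||| r) 0 = unionBits (l.flatMap (liveSucc d)) := by
      intro l hl
      induction l with
      | nil => rfl
      | cons q l ihl =>
        rw [List.foldr_cons, ihl fun r hr => hl r (List.mem_cons_of_mem q hr), List.flatMap_cons,
          unionBits_append, digitStep_nodeBits d (hl q (by simp)).1 (hl q (by simp)).2]
    rw [stateBits, List.foldr_cons, ← stateBits, ih, unionBits,
      (isUnionHom_digitStep d).map_foldr, h _ fun q => isLive_and_mem_runs]
    rfl

/-! ### Counting the vectors of sum zero -/

def zeroVecs : List Vec := liveVecs.filter fun v => decide (vecSum v = 0)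

theorem mem_zeroVecs {v : Vec} : v ∈ zeroVecs ↔ isLive v = true ∧ vecSum v = 0 := by
  rw [zeroVecs, List.mem_filter, decide_eq_true_iff]
  exact and_congr_left' ⟨fun h => (List.mem_filter.1 h).2, mem_liveVecs⟩

theorem nodup_map_zeroVecs : (zeroVecs.map fun v => vecPos v - 118).Nodup := by
  rw [zeroVecs, map_vecPos_zeroSum]
  decide

theorem testBit_outputBits_stateBits (D : List Bool) (p : ℕ) :
    (outputBits (stateBits D)).testBit p = true ↔
      ∃ q ∈ liveReach D, vecSum q.1 = 0 ∧ vecPos q.1 - 118 = p := by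
  rw [stateBits_eq, unionBits, isUnionHom_outputBits.map_foldr]
  have h : ∀ l : List Node, (∀ q ∈ l, isLive q.1 = true ∧ q.2 ∈ runs) →
      ((l.foldr (fun q r => outputBits (nodeBits q) ||| r) 0).testBit p = true ↔
        ∃ q ∈ l, vecSum q.1 = 0 ∧ vecPos q.1 - 118 = p) := by
    intro l hl
    induction l with
    | nil => simp
    | cons q l ih =>
      obtain ⟨hq, hs⟩ := hl q (by simp)
      have h := List.all_eq_true.1 outCheck_eq q.1 (mem_boxVecs (inBox_of_isLive hq))
      rw [hq, Bool.not_true, Bool.false_or] at h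
      have h := Nat.eq_of_beq_eq_true (List.all_eq_true.1 h q.2 hs)
      rw [List.foldr_cons, Nat.testBit_or, Bool.or_eq_true,
        ih fun r hr => hl r (List.mem_cons_of_mem q hr), h]
      simp only [List.mem_cons, exists_eq_or_imp]
      refine or_congr_left ?_
      split_ifs with h0 <;> simp [h0, Nat.one_shiftLeft, Nat.testBit_two_pow]
  exact h _ fun q => isLive_and_mem_runs

theorem bitCount_eq (x : ℕ) (l : List ℕ) : bitCount x l = (l.filter x.testBit).length := by
  induction l with
  | nil => rfl
  | cons p l ih =>
    have h : bitCount x (p :: l) = (x >>> p &&& 1) + bitCount x l := rfl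
    rw [h, ih, List.filter_cons, Nat.testBit, Nat.and_comm 1]
    rcases Nat.mod_two_eq_zero_or_one (x >>> p) with h' | h' <;>
      simp [Nat.and_one_is_mod, h', add_comm]

theorem setOf_vecSum_eq_zero_eq (D : List Bool) :
    {x | vecSum x = 0 ∧ ∃ s, (x, s) ∈ reach D} =
      {x | x ∈ zeroVecs ∧ (outputBits (stateBits D)).testBit (vecPos x - 118) = true} := by
  ext x
  simp only [Set.mem_ofPred_eq, testBit_outputBits_stateBits]
  constructor
  · rintro ⟨hx, s, hs⟩
    have hs := (mem_liveReach_iff hx).2 hs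
    exact ⟨mem_zeroVecs.2 ⟨(isLive_and_mem_runs hs).1, hx⟩, _, hs, hx, rfl⟩
  · rintro ⟨hx, ⟨y, s⟩, hs, hy, heq⟩
    obtain rfl := List.inj_on_of_nodup_map nodup_map_zeroVecs hx
      (mem_zeroVecs.2 ⟨(isLive_and_mem_runs hs).1, hy⟩) heq.symm
    exact ⟨hy, s, (mem_liveReach_iff hy).1 hs⟩

theorem ncard_eq_bitCount (x : ℕ) :
    Set.ncard {v | v ∈ zeroVecs ∧ x.testBit (vecPos v - 118) = true} =
      bitCount x zeroSumPositions := by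
  classical
  have h : {v | v ∈ zeroVecs ∧ x.testBit (vecPos v - 118) = true} =
      (zeroVecs.filter fun v => x.testBit (vecPos v - 118)).toFinset := by
    ext v
    simp
  rw [h, Set.ncard_coe_finset, List.toFinset_card_of_nodup (nodup_map_zeroVecs.of_map.filter _),
    bitCount_eq, ← map_vecPos_zeroSum, List.filter_map, List.length_map]
  rfl

/-! ### Abelian complexity in terms of the digits -/

theorem digitStep_iterate_zeroBits (m : ℕ) : (digitStep false)^[m] zeroBits = zeroBits :=
  Function.iterate_fixed digitStep_zeroBits m

theorem stateBits_replicate (n : ℕ) :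
    stateBits (List.replicate n false) = (digitStep false)^[n] startBits := by
  induction n with
  | zero => rfl
  | succ n ih => rw [Function.iterate_succ_apply', ← ih]; rfl

theorem stateBits_append_replicate (D : List Bool) (m : ℕ) :
    stateBits (D ++ List.replicate (m + 5) false) = D.foldr digitStep zeroBits := by
  have h : (digitStep false)^[5] startBits = zeroBits := by
    simp only [Function.iterate_succ_apply', Function.iterate_zero_apply]
    rfl
  rw [stateBits, List.foldr_append, ← stateBits, stateBits_replicate, Function.iterate_add_apply, h,
    digitStep_iterate_zeroBits]

theorem mbAC_eq_bitCount {n : ℕ} {D : List Bool} (hn : (n : ℤ) = vecSum (evalDigits D)) :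
    mbAC 4 n = bitCount (outputBits (D.foldr digitStep zeroBits)) zeroSumPositions := by
  rw [mbAC_eq_ncard, hn, factorVecs_vecSum_evalDigits,
    Set.ncard_image_of_injective _ (add_left_injective _), ← ncard_eq_bitCount]
  congr 1
  have h (m : ℕ) := setOf_vecSum_eq_zero_eq (D ++ List.replicate (m + 5) false)
  simp only [stateBits_append_replicate] at h
  rw [← h 0]
  ext x
  have h' (m : ℕ) := Set.ext_iff.1 ((h m).trans (h 0).symm) x
  simp only [Set.mem_ofPred_eq] at h' ⊢
  exact ⟨fun ⟨hx, m, hs⟩ => (h' m).1 ⟨hx, hs⟩, fun ⟨hx, hs⟩ => ⟨hx, 0, hs⟩⟩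

theorem evalDigits_append_singleton (D : List Bool) (d : Bool) :
    evalDigits (D ++ [d]) = evalDigits D + if d then powVec D.length else 0 := by
  induction D with
  | nil => cases d <;> rfl
  | cons e D ih =>
    rw [List.cons_append, evalDigits, ih, ← add_zero (digitVal e), shiftAdd_add, evalDigits]
    congr 1
    cases d
    · rfl
    · simp [powVec_succ]

/-- The digits as Booleans, least significant digit first. -/
def boolDigits (L : List ℕ) : List Bool := (L.map fun d => decide (d ≠ 0)).reverse

theorem boolDigits_cons (d : ℕ) (L : List ℕ) :
    boolDigits (d :: L) = boolDigits L ++ [decide (d ≠ 0)] := by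
  simp [boolDigits]

theorem valU_eq_vecSum {L : List ℕ} (hL : ∀ d ∈ L, d ≤ 1) :
    (valU 4 L : ℤ) = vecSum (evalDigits (boolDigits L)) := by
  induction L with
  | nil => rfl
  | cons d L ih =>
    have hd : d ≤ 1 := hL d (by simp)
    rw [boolDigits_cons, evalDigits_append_singleton, vecSum_add,
      ← ih fun e he => hL e (by simp [he]), valU]
    have hlen : (boolDigits L).length = L.length := by simp [boolDigits]
    rw [hlen]
    push_cast
    rw [length_mbIter]
    interval_cases d
    · simp [vecSum]
    · simp [add_comm]

theorem not_four_ones_infix {n : ℕ} {L : List ℕ} (h : IsNormalURep 4 n L) :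
    ¬ [true, true, true, true] <:+: boolDigits L := by
  intro hinf
  rw [boolDigits, show [true, true, true, true] = [true, true, true, true].reverse from rfl,
    List.reverse_infix] at hinf
  obtain ⟨s, t, hst⟩ := hinf
  rw [eq_comm, List.append_assoc] at hst
  obtain ⟨A, B, rfl, -, hB⟩ := List.map_eq_append_iff.1 hst
  obtain ⟨C, T, rfl, hC, -⟩ := List.map_eq_append_iff.1 hB
  obtain ⟨a, b, c, d, rfl⟩ : ∃ a b c d, C = [a, b, c, d] := List.length_eq_four.1 (by
    simpa using congrArg List.length hC)
  have h4 := h.2.2.2 _ (List.suffix_append A _)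
  simp only [List.map_cons, List.cons.injEq, decide_eq_true_eq] at hC
  obtain ⟨ha, hb, hc, hd, -⟩ := hC
  simp only [List.cons_append, List.nil_append, valU, List.length_cons, length_mbIter_add_four] at h4
  have h0 := Nat.le_mul_of_pos_left (mbIter 4 (T.length + 3)).length (Nat.pos_of_ne_zero ha)
  have h1 := Nat.le_mul_of_pos_left (mbIter 4 (T.length + 2)).length (Nat.pos_of_ne_zero hb)
  have h2 := Nat.le_mul_of_pos_left (mbIter 4 (T.length + 1)).length (Nat.pos_of_ne_zero hc)
  have h3 := Nat.le_mul_of_pos_left (mbIter 4 T.length).length (Nat.pos_of_ne_zero hd)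
  simp only [add_assoc, Nat.reduceAdd] at h4
  omega

/-- The length of the initial run of ones. -/
def onesRun : List Bool → ℕ
  | true :: D => onesRun D + 1
  | _ => 0

theorem replicate_onesRun_isPrefix (D : List Bool) :
    List.replicate (onesRun D) true <+: D := by
  induction D with
  | nil => simp [onesRun]
  | cons d D ih =>
    cases d
    · simp [onesRun]
    · simpa [onesRun, List.replicate_succ] using ih

theorem onesRun_lt_four {D : List Bool} (hD : ¬ [true, true, true, true] <:+: D) :
    onesRun D < 4 := by
  by_contra! h
  refine hD (List.IsInfix.trans (List.IsPrefix.isInfix ?_) (replicate_onesRun_isPrefix D).isInfix)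
  exact ⟨List.replicate (onesRun D - 4) true, by
    rw [show [true, true, true, true] = List.replicate 4 true from rfl,
      List.replicate_append_replicate, Nat.add_sub_cancel' h]⟩

/-! ### Soundness of the search -/

theorem force_eq {α : Type} (x : ℕ) (k : ℕ → α) : force x k = k x := by
  cases x <;> rfl

theorem listMem_cons (x a : ℕ) (l : List ℕ) :
    listMem x (a :: l) = true ↔ x = a ∨ listMem x l = true := by
  have h : listMem x (a :: l) = Bool.rec (listMem x l) true (Nat.beq x a) := rfl
  rw [h, ← Nat.beq_eq]
  cases Nat.beq x a <;> simp

namespace Trie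

theorem mem_node (x : ℕ) (l r : Trie) (k : ℕ) :
    (node l r).mem x k = if Nat.beq (k % 2) 0 then l.mem x (k / 2) else r.mem x (k / 2) := by
  have h : (node l r).mem x k =
      Bool.rec (r.mem x (k / 2)) (l.mem x (k / 2)) (Nat.beq (k % 2) 0) := rfl
  rw [h]
  cases Nat.beq (k % 2) 0 <;> rfl

theorem add_node (x : ℕ) (l r : Trie) (k : ℕ) :
    (node l r).add x k =
      if Nat.beq (k % 2) 0 then node (l.add x (k / 2)) r else node l (r.add x (k / 2)) := by
  have h : (node l r).add x k =
      Bool.rec (node l (r.add x (k / 2))) (node (l.add x (k / 2)) r) (Nat.beq (k % 2) 0) := rfl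
  rw [h]
  cases Nat.beq (k % 2) 0 <;> rfl

theorem mem_add_self (x : ℕ) (t : Trie) (k : ℕ) : (t.add x k).mem x k = true := by
  induction t generalizing k with
  | leaf l => exact (listMem_cons x x l).2 (.inl rfl)
  | node l r ihl ihr =>
    rw [add_node]
    split_ifs with h <;> rw [mem_node]
    · rw [if_pos h, ihl]
    · rw [if_neg h, ihr]

theorem mem_add_of_mem {x y : ℕ} {t : Trie} {j k : ℕ} (h : t.mem x j = true) :
    (t.add y k).mem x j = true := by
  induction t generalizing j k with
  | leaf l => exact (listMem_cons x y l).2 (.inr h)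
  | node l r ihl ihr =>
    rw [mem_node] at h
    rw [add_node]
    split_ifs <;> rw [mem_node] <;> split_ifs at h ⊢ <;> first | exact h | exact ihl h | exact ihr h

theorem eq_or_mem_of_mem_add {x y : ℕ} {t : Trie} {j k : ℕ} (h : (t.add y k).mem x j = true) :
    x = y ∨ t.mem x j = true := by
  induction t generalizing j k with
  | leaf l => exact (listMem_cons x y l).1 h
  | node l r ihl ihr =>
    rw [add_node] at h
    split_ifs at h <;> rw [mem_node] at h ⊢ <;> split_ifs at h ⊢ <;>
      first | exact .inr h | exact ihl h | exact ihr h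

theorem mem_full (x n k : ℕ) : (full n).mem x k = false := by
  induction n generalizing k with
  | zero => rfl
  | succ n ih =>
    have h : full (n + 1) = node (full n) (full n) := rfl
    rw [h, mem_node, ih, ite_self]

end Trie

/-- The bit vector, the current run of ones and the label that are packed in a state. -/
noncomputable def stateVec (x : ℕ) : ℕ := Nat.shiftRight x 15

noncomputable def stateRun (x : ℕ) : ℕ := Nat.land (Nat.shiftRight x 13) 3

noncomputable def stateRow (x : ℕ) : ℕ := row (Nat.land x 8191)

noncomputable def childZero (x : ℕ) : ℕ :=
  packState (digitStep false (stateVec x)) 0 (Nat.land (stateRow x) 8191)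

noncomputable def childOne (x : ℕ) : ℕ :=
  packState (digitStep true (stateVec x)) (stateRun x + 1)
    (Nat.land (Nat.shiftRight (stateRow x) 13) 8191)

theorem mem_pushChildren {x y : ℕ} {work : List ℕ} :
    y ∈ pushChildren (stateVec x) (stateRun x) (stateRow x) work ↔
      y = childZero x ∨ (stateRun x ≠ 3 ∧ y = childOne x) ∨ y ∈ work := by
  have h : pushChildren (stateVec x) (stateRun x) (stateRow x) work =
      Bool.rec (childZero x :: childOne x :: work) (childZero x :: work)
        (Nat.beq (stateRun x) 3) := rfl
  rw [h]
  cases hb : Nat.beq (stateRun x) 3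
  · simp [Nat.ne_of_beq_eq_false hb]
  · simp [Nat.eq_of_beq_eq_true hb]

namespace Search

/-- `x` has been visited or is waiting to be visited. -/
def Knows (σ : Search) (x : ℕ) : Prop := σ.seen.mem x x = true ∨ x ∈ σ.work

structure Invariant (start : ℕ) (σ : Search) : Prop where
  knows_start : σ.Knows start
  outputOk_of_mem : ∀ x, σ.seen.mem x x = true → outputOk (stateVec x) (stateRow x) = true
  knows_childZero : ∀ x, σ.seen.mem x x = true → σ.Knows (childZero x)
  knows_childOne : ∀ x, σ.seen.mem x x = true → stateRun x ≠ 3 → σ.Knows (childOne x)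

/-- Either the search has failed, or its invariant holds. -/
def Sound (start : ℕ) (σ : Search) : Prop :=
  σ.ok = false ∧ σ.work = [] ∨ σ.ok = true ∧ σ.Invariant start

theorem sound_visit {start : ℕ} {σ : Search} (h : σ.Sound start) : (visit σ).Sound start := by
  obtain ⟨seen, _ | ⟨x, work⟩, ok⟩ := σ
  · exact h
  obtain ⟨-, h⟩ | ⟨rfl, h⟩ := h
  · simp at h
  have hvisit : visit ⟨seen, x :: work, true⟩ = Bool.rec
      (Bool.rec ⟨seen, [], false⟩
        ⟨seen.add x x, pushChildren (stateVec x) (stateRun x) (stateRow x) work, true⟩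
        (outputOk (stateVec x) (stateRow x)))
      ⟨seen, work, true⟩ (seen.mem x x) :=
    force_eq x fun x => Bool.rec (motive := fun _ => Search)
      (visitNew x seen work (Nat.shiftRight x 15) (row (Nat.land x 8191)))
      ⟨seen, work, true⟩ (Trie.mem x seen x)
  rw [hvisit]
  cases hx : seen.mem x x
  · cases hout : outputOk (stateVec x) (stateRow x)
    · exact .inl ⟨rfl, rfl⟩
    · refine .inr ⟨rfl, ?_⟩
      have hknows {y : ℕ} (hy : Knows ⟨seen, x :: work, true⟩ y) : Knows ⟨seen.add x x,
          pushChildren (stateVec x) (stateRun x) (stateRow x) work, true⟩ y := by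
        obtain hy | hy := hy
        · exact .inl (Trie.mem_add_of_mem hy)
        · obtain rfl | hy := List.mem_cons.1 hy
          · exact .inl (Trie.mem_add_self ..)
          · exact .inr (mem_pushChildren.2 (.inr (.inr hy)))
      refine ⟨hknows h.knows_start, fun y hy => ?_, fun y hy => ?_, fun y hy hrun => ?_⟩ <;>
        obtain rfl | hy := Trie.eq_or_mem_of_mem_add hy
      · exact hout
      · exact h.outputOk_of_mem y hy
      · exact .inr (mem_pushChildren.2 (.inl rfl))
      · exact hknows (h.knows_childZero y hy)
      · exact .inr (mem_pushChildren.2 (.inr (.inl ⟨hrun, rfl⟩)))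
      · exact hknows (h.knows_childOne y hy hrun)
  · have hknows {y : ℕ} (hy : Knows ⟨seen, x :: work, true⟩ y) :
        Knows ⟨seen, work, true⟩ y := by
      obtain hy | hy := hy
      · exact .inl hy
      · obtain rfl | hy := List.mem_cons.1 hy
        · exact .inl hx
        · exact .inr hy
    exact .inr ⟨rfl, hknows h.knows_start, h.outputOk_of_mem, fun y hy => hknows (h.knows_childZero y hy),
      fun y hy hrun => hknows (h.knows_childOne y hy hrun)⟩

theorem sound_iterate2 {start : ℕ} {σ : Search} (h : σ.Sound start) (n : ℕ) :
    (iterate2 visit n σ).Sound start := by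
  induction n generalizing σ with
  | zero => exact sound_visit h
  | succ n ih => exact ih (ih h)

end Search

noncomputable def startState : ℕ := packState (digitStep true zeroBits) 1 0

theorem sound_searchState (k : ℕ) : (searchState k).Sound startState :=
  Search.sound_iterate2 (σ := ⟨Trie.full 13, [startState], true⟩) (.inr ⟨rfl,
    .inr (List.mem_singleton.2 rfl), fun x hx => by simp [Trie.mem_full] at hx,
    fun x hx => by simp [Trie.mem_full] at hx, fun x hx => by simp [Trie.mem_full] at hx⟩) k

theorem Search.Sound.invariant {start : ℕ} {σ : Search} (h : σ.Sound start) (hd : isDone σ = true) :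
    σ.Invariant start ∧ σ.work = [] := by
  obtain ⟨seen, _ | ⟨x, work⟩, ok⟩ := σ
  · change ok = true at hd
    obtain ⟨h, -⟩ | ⟨-, h⟩ := h
    · rw [hd] at h; simp at h
    · exact ⟨h, rfl⟩
  · change false = true at hd
    simp at hd

theorem packState_eq (S t i : ℕ) :
    packState S t i = 2 ^ 15 * S + (2 ^ 13 * t + i) := by
  have h : packState S t i = S <<< 15 + (t <<< 13 + i) := rfl
  rw [h, Nat.shiftLeft_eq, Nat.shiftLeft_eq, mul_comm, mul_comm t]

theorem stateVec_packState {S t i : ℕ} (ht : t < 4) (hi : i < 8192) :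
    stateVec (packState S t i) = S := by
  have h (x : ℕ) : stateVec x = x / 2 ^ 15 := Nat.shiftRight_eq_div_pow ..
  rw [h, packState_eq]
  omega

theorem stateRun_packState {S t i : ℕ} (ht : t < 4) (hi : i < 8192) :
    stateRun (packState S t i) = t := by
  have h (x : ℕ) : stateRun x = x / 2 ^ 13 % 2 ^ 2 := by
    rw [← Nat.shiftRight_eq_div_pow, ← Nat.and_two_pow_sub_one_eq_mod]
    rfl
  rw [h, packState_eq]
  omega

theorem stateRow_packState {S t i : ℕ} (hi : i < 8192) :
    stateRow (packState S t i) = row i := by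
  have h (x : ℕ) : stateRow x = row (x % 2 ^ 13) := by
    rw [← Nat.and_two_pow_sub_one_eq_mod]
    rfl
  rw [h, packState_eq]
  congr 1
  omega

noncomputable def nextLabel (d : Bool) (i : ℕ) : ℕ :=
  if d then Nat.land (Nat.shiftRight (row i) 13) 8191 else Nat.land (row i) 8191

theorem nextLabel_lt (d : Bool) (i : ℕ) : nextLabel d i < 8192 := by
  unfold nextLabel
  split_ifs <;> exact Nat.lt_succ_of_le Nat.and_le_right

/-- The label that is reached after reading the digit `1` followed by the digits `D`. -/
noncomputable def label (D : List Bool) : ℕ := D.foldr nextLabel 0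

theorem label_lt (D : List Bool) : label D < 8192 := by
  cases D with
  | nil => simp [label]
  | cons d D => exact nextLabel_lt ..

theorem mem_seen_searchState (D : List Bool)
    (hD : ¬ [true, true, true, true] <:+: D ++ [true]) :
    (searchState 15).seen.mem
      (packState ((D ++ [true]).foldr digitStep zeroBits) (onesRun (D ++ [true])) (label D))
      (packState ((D ++ [true]).foldr digitStep zeroBits) (onesRun (D ++ [true])) (label D)) =
        true := by
  obtain ⟨hinv, hwork⟩ := (sound_searchState 15).invariant isDone_searchState
  have hknows {x : ℕ} (hx : (searchState 15).Knows x) : (searchState 15).seen.mem x x = true :=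
    hx.resolve_right (by simp [hwork])
  induction D with
  | nil => exact hknows hinv.knows_start
  | cons d D ih =>
    have hD' : ¬ [true, true, true, true] <:+: D ++ [true] := fun h =>
      hD (h.trans (List.suffix_cons d (D ++ [true])).isInfix)
    have ih := ih hD'
    have ht := onesRun_lt_four hD'
    have hi := label_lt D
    cases d
    · have h := hknows (hinv.knows_childZero _ ih)
      rw [childZero, stateVec_packState ht hi, stateRow_packState hi] at h
      exact h
    · have h3 := onesRun_lt_four hD
      have h := hknows (hinv.knows_childOne _ ih (by
        rw [stateRun_packState ht hi]
        simp only [List.cons_append, onesRun] at h3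
        omega))
      rw [childOne, stateVec_packState ht hi, stateRow_packState hi,
        stateRun_packState ht hi] at h
      exact h

theorem bitCount_eq_row (D : List Bool) (hD : ¬ [true, true, true, true] <:+: D ++ [true]) :
    bitCount (outputBits ((D ++ [true]).foldr digitStep zeroBits)) zeroSumPositions =
      row (label D) >>> 26 := by
  obtain ⟨hinv, -⟩ := (sound_searchState 15).invariant isDone_searchState
  have h := hinv.outputOk_of_mem _ (mem_seen_searchState D hD)
  have ht := onesRun_lt_four hD
  have hi := label_lt D
  rw [stateVec_packState ht hi, stateRow_packState hi, outputOk, force_eq] at h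
  exact Nat.eq_of_beq_eq_true h

/-! ### The automaton -/

theorem nextLabel_lt_of_lt {i : ℕ} (hi : i < 5612) :
    nextLabel false i < 5611 ∧ nextLabel true i < 5611 := by
  have h : ∀ a < 75, ∀ b < 75,
      nextLabel false (75 * a + b) < 5611 ∧ nextLabel true (75 * a + b) < 5611 := by
    decide +kernel
  rw [← Nat.div_add_mod i 75]
  exact h _ (by omega) _ (by omega)

theorem row_shiftRight_mem_Icc {i : ℕ} (hi : i < 5611) :
    4 ≤ row i >>> 26 ∧ row i >>> 26 ≤ 16 := by
  have h : ∀ a < 75, ∀ b < 75, 5611 ≤ 75 * a + b ∨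
      4 ≤ row (75 * a + b) >>> 26 ∧ row (75 * a + b) >>> 26 ≤ 16 := by
    decide +kernel
  have h := h (i / 75) (by omega) (i % 75) (by omega)
  rw [Nat.div_add_mod] at h
  exact h.resolve_left (by omega)

theorem nextLabel_initial (d : Bool) : nextLabel d 5611 = 0 := by
  cases d <;> decide +kernel

theorem label_lt_of_row (D : List Bool) : label D < 5611 := by
  induction D with
  | nil => simp [label]
  | cons d D ih =>
    have h := nextLabel_lt_of_lt (i := label D) (by omega)
    cases d
    · exact h.1
    · exact h.2

noncomputable def transition (q : Fin 5612) (a : Fin 2) : Fin 5612 :=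
  ⟨nextLabel (decide (a ≠ 0)) q, by
    have h := nextLabel_lt_of_lt q.2
    cases decide (a ≠ 0)
    · exact h.1.trans (by norm_num)
    · exact h.2.trans (by norm_num)⟩

theorem foldl_transition (L : List ℕ) (q : Fin 5612) :
    ((L.foldl (fun q d => transition q (if d = 0 then 0 else 1)) q : Fin 5612) : ℕ) =
      (boolDigits L).foldr nextLabel q := by
  induction L generalizing q with
  | nil => rfl
  | cons d L ih =>
    rw [List.foldl_cons, ih, boolDigits_cons, List.foldr_append]
    by_cases hd : d = 0 <;> simp [hd, transition]

/-- A digit string of a positive number starts with `1`. -/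
theorem exists_boolDigits_eq {n : ℕ} (hn : 1 ≤ n) {L : List ℕ} (h : IsNormalURep 4 n L) :
    ∃ D, boolDigits L = D ++ [true] := by
  obtain ⟨-, h1, rfl, -⟩ := h
  cases L with
  | nil => simp [valU] at hn
  | cons d L =>
    obtain rfl : d = 1 := h1 d (by simp)
    exact ⟨boolDigits L, by simp [boolDigits_cons]⟩

noncomputable def output (q : Fin 5612) : ℕ := max 4 (min 16 (row q >>> 26))

theorem mbAC_eq_output {n : ℕ} (hn : 1 ≤ n) {L : List ℕ} (hL : IsNormalURep 4 n L) :
    mbAC 4 n = output (L.foldl (fun q d => transition q (if d = 0 then 0 else 1))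
      ⟨5611, by norm_num⟩) := by
  obtain ⟨D, hD⟩ := exists_boolDigits_eq hn hL
  have hones := not_four_ones_infix hL
  rw [hD] at hones
  have hval := valU_eq_vecSum hL.1
  rw [hL.2.2.1, hD] at hval
  have hlabel : (boolDigits L).foldr nextLabel 5611 = label D := by
    rw [hD, List.foldr_append, List.foldr_cons, List.foldr_nil, nextLabel_initial, label]
  have hrow := row_shiftRight_mem_Icc (label_lt_of_row D)
  rw [output, foldl_transition, hlabel, mbAC_eq_bitCount hval, bitCount_eq_row D hones,
    min_eq_right hrow.2, max_eq_right hrow.1]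

end FourBonacci

theorem fourbonacci_abelian_complexity_Q_automatic :
    ∃ k : ℕ, 1 ≤ k ∧ k ≤ 5665 ∧
      ∃ (δ : Fin k → Fin 2 → Fin k) (q0 : Fin k) (τ : Fin k → ℕ),
        (∀ q, τ q ∈ Set.Icc 4 16) ∧
        ∀ n : ℕ, 1 ≤ n → ∀ L : List ℕ, IsNormalURep 4 n L →
          mbAC 4 n = τ (L.foldl (fun q d => δ q (if d = 0 then 0 else 1)) q0) := by
  refine ⟨5612, by norm_num, by norm_num, FourBonacci.transition, ⟨5611, by norm_num⟩,
    FourBonacci.output, fun q => ?_, fun n hn L => FourBonacci.mbAC_eq_output hn⟩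
  simp [FourBonacci.output]
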